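/- arXiv:1508.02239 — 3 statements merged into one kernel-verified Lean document; each statement's English description precedes it below -/
import Mathlib

section
/- Let (Ω,Σ,μ) be a complete and saturated finite measure space and let X be a separable Asplund space. If Γ: Ω ⇉ X* is an integrably bounded, w*-scalarly measurable multifunction with nonempty w*-closed values, then the Gelfand integral I(Γ) is weak*-compact and convex, and I(Γ) = I( cl^{w*} co Γ ), where cl^{w*} co Γ is the multifunction ω ↦ weak*-closed convex hull of Γ(ω). -/
open MeasureTheory Filter Topology Metric Set Pointwise
open scoped NNReal ENNReal

noncomputable section

universe u v

namespace Paper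

section Defs

variable {X : Type u} [NormedAddCommGroup X] [NormedSpace ℝ X]
variable {Ω : Type v} [MeasurableSpace Ω]

/-- The identity map from the (strong) dual to the dual endowed with the weak* topology. -/
def wstar : (X →L[ℝ] ℝ) → WeakDual ℝ X := fun φ => φ

/-- Support function `s(x,C)` of a set `C ⊆ X*`. -/
def supp (x : X) (C : Set (X →L[ℝ] ℝ)) : ℝ :=
  sSup ((fun φ : X →L[ℝ] ℝ => φ x) '' C)

/-- `f` is Gelfand integrable: all scalarizations are integrable and the scalar
integrals are represented by a continuous linear functional. -/
def GelfandIntegrable (μ : Measure Ω) (f : Ω → X →L[ℝ] ℝ) : Prop :=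
  (∀ x : X, Integrable (fun ω => f ω x) μ) ∧
    ∃ g : X →L[ℝ] ℝ, ∀ x : X, g x = ∫ ω, f ω x ∂μ

/-- The set `S¹_Γ` of Gelfand-integrable a.e. selectors of `Γ`. -/
def selectors (μ : Measure Ω) (Γ : Ω → Set (X →L[ℝ] ℝ)) : Set (Ω → X →L[ℝ] ℝ) :=
  { f | GelfandIntegrable μ f ∧ ∀ᵐ ω ∂μ, f ω ∈ Γ ω }

/-- The Gelfand integral `I(Γ) = { ∫ f dμ : f ∈ S¹_Γ }` of a multifunction. -/
def gelfandIntegral (μ : Measure Ω) (Γ : Ω → Set (X →L[ℝ] ℝ)) : Set (X →L[ℝ] ℝ) :=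
  { g | ∃ f ∈ selectors μ Γ, ∀ x : X, g x = ∫ ω, f ω x ∂μ }

/-- The set `S^{1,w*}_Γ` of Gelfand-integrable w*-almost selectors of `Γ`. -/
def almostSelectors (μ : Measure Ω) (Γ : Ω → Set (X →L[ℝ] ℝ)) : Set (Ω → X →L[ℝ] ℝ) :=
  { f | GelfandIntegrable μ f ∧ ∀ x : X, ∀ᵐ ω ∂μ, f ω x ≤ supp x (Γ ω) }

/-- `Γ` is w*-scalarly measurable. -/
def WScalarlyMeasurable (Γ : Ω → Set (X →L[ℝ] ℝ)) : Prop :=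
  ∀ x : X, Measurable fun ω => supp x (Γ ω)

/-- `Γ` is w*-scalarly integrable. -/
def WScalarlyIntegrable (μ : Measure Ω) (Γ : Ω → Set (X →L[ℝ] ℝ)) : Prop :=
  ∀ x : X, Integrable (fun ω => supp x (Γ ω)) μ

/-- `Γ` is integrably bounded. -/
def IntegrablyBounded (μ : Measure Ω) (Γ : Ω → Set (X →L[ℝ] ℝ)) : Prop :=
  ∃ ψ : Ω → ℝ, Integrable ψ μ ∧ ∀ ω : Ω, ∀ φ ∈ Γ ω, ‖φ‖ ≤ ψ ω

/-- `C ⊆ X*` is weak*-closed. -/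
def WStarClosed (C : Set (X →L[ℝ] ℝ)) : Prop := IsClosed (wstar '' C)

/-- `C ⊆ X*` is weak*-compact. -/
def WStarCompact (C : Set (X →L[ℝ] ℝ)) : Prop := IsCompact (wstar '' C)

/-- Weak*-closure of `C ⊆ X*`. -/
def wstarClosure (C : Set (X →L[ℝ] ℝ)) : Set (X →L[ℝ] ℝ) :=
  wstar ⁻¹' closure (wstar '' C)

/-- Weak*-closed convex hull of `C ⊆ X*`. -/
def wstarClosedConvexHull (C : Set (X →L[ℝ] ℝ)) : Set (X →L[ℝ] ℝ) :=
  wstar ⁻¹' closure (convexHull ℝ (wstar '' C))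

/-- `Y` is an Asplund space: every continuous convex real function on an open convex
set is Fréchet differentiable on a dense subset of that set. -/
def Asplund (Y : Type*) [NormedAddCommGroup Y] [NormedSpace ℝ Y] : Prop :=
  ∀ U : Set Y, IsOpen U → Convex ℝ U →
    ∀ f : Y → ℝ, ContinuousOn f U → ConvexOn ℝ U f →
      U ⊆ closure { y | y ∈ U ∧ ∃ f' : Y →L[ℝ] ℝ, HasFDerivWithinAt f f' U y }

/-- `μ` is a nonatomic measure. -/
def Nonatomic (μ : Measure Ω) : Prop :=
  ∀ A : Set Ω, MeasurableSet A → 0 < μ A →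
    ∃ B : Set Ω, MeasurableSet B ∧ B ⊆ A ∧ 0 < μ B ∧ μ B < μ A

/-- `μ` is a saturated measure: `L¹` of every positive-measure restriction is nonseparable. -/
def Saturated (μ : Measure Ω) : Prop :=
  ∀ E : Set Ω, MeasurableSet E → 0 < μ E →
    ¬ TopologicalSpace.SeparableSpace (Lp ℝ 1 (μ.restrict E))

/-- `dens(Y)`: smallest cardinality of a dense subset of the open unit ball of `Y`. -/
def densCard (Y : Type u) [NormedAddCommGroup Y] : Cardinal.{u} :=
  sInf { c : Cardinal.{u} |
    ∃ D : Set Y, D ⊆ ball (0 : Y) 1 ∧ ball (0 : Y) 1 ⊆ closure D ∧ Cardinal.mk ↥D = c }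

/-- `dens(Y) < κ(μ)`: every family of `μ`-null measurable sets of cardinality at most
`dens(Y)` has measurable union. -/
def DensLtAdditivity (Y : Type u) [NormedAddCommGroup Y] (μ : Measure Ω) : Prop :=
  ∀ 𝒞 : Set (Set Ω), (∀ A ∈ 𝒞, MeasurableSet A ∧ μ A = 0) →
    Cardinal.lift.{u} (Cardinal.mk ↥𝒞) ≤ Cardinal.lift.{v} (densCard Y) →
    MeasurableSet (⋃₀ 𝒞)

/-- Clarke generalized directional derivative `ψ°(x̄;h)`. -/
def clarkeDD (ψ : X → ℝ) (xbar h : X) : ℝ :=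
  limsup (fun p : X × ℝ => (ψ (p.1 + p.2 • h) - ψ p.1) / p.2) ((𝓝 xbar) ×ˢ (𝓝[>] (0 : ℝ)))

/-- Clarke generalized gradient `∂°ψ(x̄)`. -/
def clarkeSubdiff (ψ : X → ℝ) (xbar : X) : Set (X →L[ℝ] ℝ) :=
  { φ | ∀ h : X, φ h ≤ clarkeDD ψ xbar h }

/-- `ψ` is (Clarke) regular at `x̄`: the directional derivative exists and equals `ψ°`. -/
def ClarkeRegularAt (ψ : X → ℝ) (xbar : X) : Prop :=
  ∀ h : X, Tendsto (fun θ : ℝ => (ψ (xbar + θ • h) - ψ xbar) / θ) (𝓝[>] (0 : ℝ))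
    (𝓝 (clarkeDD ψ xbar h))

/-- Limiting (Mordukhovich) subdifferential `∂ψ(x̄)`. -/
def limitingSubdiff (ψ : X → ℝ) (xbar : X) : Set (X →L[ℝ] ℝ) :=
  { p | ∃ (xk : ℕ → X) (pk : ℕ → X →L[ℝ] ℝ),
      Tendsto xk atTop (𝓝 xbar) ∧
      (∀ z : X, Tendsto (fun k => pk k z) atTop (𝓝 (p z))) ∧
      ∀ k : ℕ, 0 ≤ liminf
        (fun y => (ψ y - ψ (xk k) - pk k (y - xk k)) / ‖y - xk k‖) (𝓝[≠] (xk k)) }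

/-- Clarke generalized normal cone `N°(z̄;C)`. -/
def clarkeNormalCone (C : Set X) (zbar : X) : Set (X →L[ℝ] ℝ) :=
  wstarClosure (⋃ α ∈ Ioi (0 : ℝ), α • clarkeSubdiff (fun z => infDist z C) zbar)

/-- Limiting normal cone `N(z̄;C)`. -/
def limitingNormalCone (C : Set X) (zbar : X) : Set (X →L[ℝ] ℝ) :=
  ⋃ α ∈ Ioi (0 : ℝ), α • limitingSubdiff (fun z => infDist z C) zbar

/-- A multifunction is lower semicontinuous. -/
def LowerSC {Y : Type*} [TopologicalSpace Y] {Z : Type*} [TopologicalSpace Z]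
    (F : Y → Set Z) : Prop :=
  ∀ U : Set Z, IsOpen U → IsOpen { y | (F y ∩ U).Nonempty }

/-- A multifunction is upper semicontinuous. -/
def UpperSC {Y : Type*} [TopologicalSpace Y] {Z : Type*} [TopologicalSpace Z]
    (F : Y → Set Z) : Prop :=
  ∀ U : Set Z, IsOpen U → IsOpen { y | F y ⊆ U }

/-- `P` is a stochastic kernel (transition probability). -/
def StochasticKernel (P : Ω → Measure Ω) : Prop :=
  (∀ ω, IsProbabilityMeasure (P ω)) ∧
    ∀ A : Set Ω, MeasurableSet A → Measurable fun ω => P ω A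

/-- `v` is a bounded Carathéodory solution of the Bellman equation, the minimum
over `Γ x ω` being attained. -/
def BellmanSolution (P : Ω → Measure Ω) (β : ℝ) (u : X → X → Ω → ℝ)
    (Γ : X → Ω → Set X) (v : X → Ω → ℝ) : Prop :=
  (∃ M : ℝ, ∀ x ω, |v x ω| ≤ M) ∧
  (∀ ω, Continuous fun x => v x ω) ∧
  (∀ x, Measurable fun ω => v x ω) ∧
  ∀ x ω,
    (∃ y ∈ Γ x ω, v x ω = u x y ω + β * ∫ ω', v y ω' ∂(P ω)) ∧
    ∀ y ∈ Γ x ω, v x ω ≤ u x y ω + β * ∫ ω', v y ω' ∂(P ω)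

/-- The policy multifunction `G(x,ω)` associated with a Bellman solution `v`. -/
def policyMap (P : Ω → Measure Ω) (β : ℝ) (u : X → X → Ω → ℝ)
    (Γ : X → Ω → Set X) (v : X → Ω → ℝ) (x : X) (ω : Ω) : Set X :=
  { y ∈ Γ x ω | v x ω = u x y ω + β * ∫ ω', v y ω' ∂(P ω) }

/-- Standing assumptions (H1), (H2) on the stochastic DP problem. -/
def DPStandingAssumptions [MeasurableSpace X] (P : Ω → Measure Ω) (β : ℝ)
    (u : X → X → Ω → ℝ) (Γ : X → Ω → Set X) : Prop :=
  StochasticKernel P ∧ 0 ≤ β ∧ β < 1 ∧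
  (∃ M : ℝ, ∀ x y ω, |u x y ω| ≤ M) ∧
  (∀ ω, Continuous fun p : X × X => u p.1 p.2 ω) ∧
  (∀ x y, Measurable fun ω => u x y ω) ∧
  (∀ x ω, (Γ x ω).Nonempty ∧ IsCompact (Γ x ω)) ∧
  (∀ U : Set X, IsOpen U → MeasurableSet { p : X × Ω | (Γ p.1 p.2 ∩ U).Nonempty }) ∧
  (∀ ω, LowerSC (fun x => Γ x ω) ∧ UpperSC (fun x => Γ x ω)) ∧
  (∀ x, ∀ U : Set X, IsOpen U → MeasurableSet { ω | (Γ x ω ∩ U).Nonempty })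

/-- `G` is locally lower viable around `x̄` (relative to `Γ`). -/
def LocLowerViable (G Γ : X → Ω → Set X) (xbar : X) : Prop :=
  ∀ ω, ∃ U ∈ 𝓝 xbar, ∀ x ∈ U, ∀ x' ∈ U, (G x ω ∩ Γ x' ω).Nonempty

/-- `G` is locally upper viable around `x̄` (relative to `Γ`). -/
def LocUpperViable (G Γ : X → Ω → Set X) (xbar : X) : Prop :=
  ∀ ω, ∃ U ∈ 𝓝 xbar, ∀ x ∈ U, ∀ x' ∈ U, G x ω ⊆ Γ x' ω

end Defs

section SublinearSelection

variable {X : Type u} [NormedAddCommGroup X]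

/-- `p` is subadditive, homogeneous under natural multiples, and bounded above by `c * ‖·‖`. -/
structure BoundedSublinear (p : X → ℝ) (c : ℝ) : Prop where
  add_le : ∀ x y, p (x + y) ≤ p x + p y
  le_mul_norm : ∀ x, p x ≤ c * ‖x‖
  mul_le_nsmul : ∀ (m : ℕ) (x : X), m * p x ≤ p (m • x)

theorem nonneg_zero_of_add_le {p : X → ℝ} (hadd : ∀ x y, p (x + y) ≤ p x + p y) : 0 ≤ p 0 := by
  have := hadd 0 0
  simp only [add_zero] at this
  linarith

theorem nonneg_add_neg_of_add_le {p : X → ℝ} (hadd : ∀ x y, p (x + y) ≤ p x + p y) (x : X) :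
    0 ≤ p x + p (-x) := by
  have h := hadd x (-x)
  rw [add_neg_cancel] at h
  exact (nonneg_zero_of_add_le hadd).trans h

theorem neg_le_of_add_le {p : X → ℝ} {c : ℝ} (hadd : ∀ x y, p (x + y) ≤ p x + p y)
    (hle : ∀ x, p x ≤ c * ‖x‖) (x : X) : -(c * ‖x‖) ≤ p x := by
  have h1 := nonneg_add_neg_of_add_le hadd x
  have h2 := hle (-x)
  rw [norm_neg] at h2
  linarith

theorem continuous_of_add_le {p : X → ℝ} {c : ℝ} (hadd : ∀ x y, p (x + y) ≤ p x + p y)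
    (hle : ∀ x, p x ≤ c * ‖x‖) : Continuous p := by
  refine (LipschitzWith.of_le_add_mul' c fun x y => ?_).continuous
  have h := hadd y (x - y)
  rw [add_sub_cancel] at h
  rw [dist_eq_norm]
  linarith [hle (x - y)]

/-- A subadditive function bounded by a multiple of the norm that is odd on a dense set is a
continuous linear functional. -/
theorem exists_clm_of_odd_on_dense [NormedSpace ℝ X] {p : X → ℝ} {c : ℝ}
    (hadd : ∀ x y, p (x + y) ≤ p x + p y)
    (hle : ∀ x, p x ≤ c * ‖x‖) {D : Set X} (hD : Dense D) (hodd : ∀ d ∈ D, p d + p (-d) ≤ 0) :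
    ∃ φ : X →L[ℝ] ℝ, ∀ x, φ x = p x := by
  have hc := continuous_of_add_le hadd hle
  have hodd' : ∀ x, p x + p (-x) ≤ 0 := by
    have hcl : IsClosed {x | p x + p (-x) ≤ 0} :=
      isClosed_le (hc.add (hc.comp continuous_neg)) continuous_const
    intro x
    exact hcl.closure_subset_iff.2 hodd (hD x)
  have hadd' : ∀ x y, p (x + y) = p x + p y := by
    intro x y
    refine le_antisymm (hadd x y) ?_
    have h := hadd (x + y) (-y)
    rw [add_neg_cancel_right] at h
    linarith [hodd' y]
  exact ⟨(AddMonoidHom.mk' p hadd').toRealLinearMap hc, fun x => rfl⟩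

theorem BoundedSublinear.zero_nonneg {p : X → ℝ} {c : ℝ} (hp : BoundedSublinear p c) :
    0 ≤ p 0 := nonneg_zero_of_add_le hp.add_le

theorem BoundedSublinear.continuous {p : X → ℝ} {c : ℝ} (hp : BoundedSublinear p c) :
    Continuous p := continuous_of_add_le hp.add_le hp.le_mul_norm

/-- If `p` is the support function of a set, `faceSupport p z` is the support function of its
face in the direction `z`. -/
def faceSupport (p : X → ℝ) (z x : X) : ℝ := ⨅ k : ℕ, (p (x + k • z) - k * p z)

theorem BoundedSublinear.bddBelow_faceSupport {p : X → ℝ} {c : ℝ} (hp : BoundedSublinear p c)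
    (z x : X) : BddBelow (range fun k : ℕ => p (x + k • z) - k * p z) := by
  refine ⟨-p (-x), ?_⟩
  rintro _ ⟨k, rfl⟩
  have h := hp.add_le (x + k • z) (-x)
  have e : x + k • z + -x = k • z := by abel
  rw [e] at h
  have := hp.mul_le_nsmul k z
  dsimp only
  linarith

theorem BoundedSublinear.faceSupport_le {p : X → ℝ} {c : ℝ} (hp : BoundedSublinear p c)
    (z x : X) : faceSupport p z x ≤ p x := by
  simpa [Paper.faceSupport] using ciInf_le (hp.bddBelow_faceSupport z x) 0

theorem BoundedSublinear.antitone_faceSupport {p : X → ℝ} {c : ℝ} (hp : BoundedSublinear p c)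
    (z x : X) : Antitone fun k : ℕ => p (x + k • z) - k * p z := by
  refine antitone_nat_of_succ_le fun k => ?_
  have h := hp.add_le (x + k • z) z
  have e : x + k • z + z = x + (k + 1) • z := by rw [succ_nsmul]; abel
  rw [e] at h
  push_cast
  linarith

theorem BoundedSublinear.faceSupport {p : X → ℝ} {c : ℝ} (hp : BoundedSublinear p c) (z : X) :
    BoundedSublinear (faceSupport p z) c where
  add_le x y := by
    refine le_ciInf_add_ciInf fun k l => ?_
    refine (ciInf_le (hp.bddBelow_faceSupport z (x + y)) (k + l)).trans ?_
    have h := hp.add_le (x + k • z) (y + l • z)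
    have e : x + k • z + (y + l • z) = x + y + (k + l) • z := by rw [add_nsmul]; abel
    rw [e] at h
    push_cast
    linarith
  le_mul_norm x := (hp.faceSupport_le z x).trans (hp.le_mul_norm x)
  mul_le_nsmul m x := by
    refine le_ciInf fun k => ?_
    rcases Nat.eq_zero_or_pos m with rfl | hm
    · have := hp.mul_le_nsmul k z
      simp only [CharP.cast_eq_zero, zero_mul, zero_smul, zero_add]
      linarith
    have h1 : k ≤ m * k := Nat.le_mul_of_pos_left k hm
    have h2 := hp.antitone_faceSupport z (m • x) h1
    have h3 := hp.mul_le_nsmul m (x + k • z)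
    rw [nsmul_add, ← mul_nsmul'] at h3
    have h4 := mul_le_mul_of_nonneg_left (ciInf_le (hp.bddBelow_faceSupport z x) k)
      (Nat.cast_nonneg (α := ℝ) m)
    dsimp only at h2 h4
    push_cast at h2
    unfold Paper.faceSupport
    nlinarith

theorem BoundedSublinear.faceSupport_neg_le {p : X → ℝ} {c : ℝ} (hp : BoundedSublinear p c)
    (z : X) : Paper.faceSupport p z (-z) ≤ -p z := by
  have h := ciInf_le (hp.bddBelow_faceSupport z (-z)) 1
  have h0 := hp.le_mul_norm 0
  simp only [one_smul, neg_add_cancel, Nat.cast_one, one_mul, norm_zero, mul_zero] at h h0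
  refine h.trans ?_
  linarith

/-- Successive faces of `p` in the directions `z 0, z 1, …`. -/
def iterFaceSupport (p : X → ℝ) (z : ℕ → X) : ℕ → X → ℝ
  | 0 => p
  | n + 1 => faceSupport (iterFaceSupport p z n) (z n)

theorem BoundedSublinear.iterFaceSupport {p : X → ℝ} {c : ℝ} (hp : BoundedSublinear p c)
    (z : ℕ → X) (n : ℕ) : BoundedSublinear (iterFaceSupport p z n) c := by
  induction n with
  | zero => exact hp
  | succ n ih => exact ih.faceSupport (z n)

/-- The linear functional selected lexicographically along the directions `z 0, z 1, …`. -/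
def lexSupport (p : X → ℝ) (z : ℕ → X) (x : X) : ℝ := ⨅ n, iterFaceSupport p z n x

theorem BoundedSublinear.exists_clm_lexSupport [NormedSpace ℝ X] {p : X → ℝ} {c : ℝ}
    (hp : BoundedSublinear p c)
    {z : ℕ → X} (hz : DenseRange z) :
    ∃ φ : X →L[ℝ] ℝ, (∀ x, φ x = lexSupport p z x) ∧ (∀ x, φ x ≤ p x) ∧ φ (z 0) = p (z 0) := by
  have hu := hp.iterFaceSupport z
  have hanti : ∀ x, Antitone fun n => Paper.iterFaceSupport p z n x := fun x =>
    antitone_nat_of_succ_le fun n => (hu n).faceSupport_le _ _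
  have hbdd : ∀ x, BddBelow (range fun n => Paper.iterFaceSupport p z n x) := fun x =>
    ⟨-(c * ‖x‖), by
      rintro _ ⟨n, rfl⟩
      exact neg_le_of_add_le (hu n).add_le (hu n).le_mul_norm x⟩
  have hle : ∀ n x, lexSupport p z x ≤ Paper.iterFaceSupport p z n x := fun n x =>
    ciInf_le (hbdd x) n
  have hneg : ∀ n, lexSupport p z (-z n) ≤ -Paper.iterFaceSupport p z n (z n) := fun n =>
    (hle (n + 1) (-z n)).trans ((hu n).faceSupport_neg_le (z n))
  obtain ⟨φ, hφ⟩ := exists_clm_of_odd_on_dense (p := lexSupport p z) (c := c) (D := range z)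
    (fun x y => le_ciInf_add_ciInf fun m n => by
      refine (hle (max m n) _).trans (((hu _).add_le x y).trans ?_)
      exact add_le_add (hanti x (le_max_left m n)) (hanti y (le_max_right m n)))
    (fun x => (hle 0 x).trans (hp.le_mul_norm x)) hz
    (by
      rintro _ ⟨n, rfl⟩
      linarith [hle n (z n), hneg n])
  have hφp : ∀ x, φ x ≤ p x := fun x => (hφ x).trans_le (hle 0 x)
  refine ⟨φ, hφ, hφp, le_antisymm (hφp _) ?_⟩
  have h := hneg 0
  rw [← hφ, map_neg] at h
  exact neg_le_neg_iff.1 h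

/-- Measurable selection of a linear functional dominated by a measurable family of sublinear
functions and touching it at a prescribed point. -/
theorem exists_measurable_selection [NormedSpace ℝ X]
    [TopologicalSpace.SeparableSpace X] {Ω : Type v} [MeasurableSpace Ω]
    {q : Ω → X → ℝ} {c : Ω → ℝ} (hq : ∀ ω, BoundedSublinear (q ω) (c ω))
    (hqm : ∀ x, Measurable fun ω => q ω x) (x₀ : X) :
    ∃ h : Ω → X →L[ℝ] ℝ, (∀ x, Measurable fun ω => h ω x) ∧ (∀ ω x, h ω x ≤ q ω x) ∧
      ∀ ω, h ω x₀ = q ω x₀ := by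
  let z : ℕ → X := fun n => Nat.casesOn n x₀ (TopologicalSpace.denseSeq X)
  have hz : DenseRange z :=
    (TopologicalSpace.denseRange_denseSeq X).mono (by rintro _ ⟨n, rfl⟩; exact ⟨n + 1, rfl⟩)
  choose h hlex hle heq using fun ω => (hq ω).exists_clm_lexSupport hz
  refine ⟨h, fun x => ?_, hle, heq⟩
  have hm : ∀ n x, Measurable fun ω => iterFaceSupport (q ω) z n x := by
    intro n
    induction n with
    | zero => exact hqm
    | succ n ih =>
      exact fun x => Measurable.iInf fun k => (ih _).sub ((ih _).const_mul _)
  simp_rw [hlex]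
  exact Measurable.iInf fun n => hm n x

end SublinearSelection

section SupportFunction

variable {X : Type u} [NormedAddCommGroup X] [NormedSpace ℝ X]

theorem bddAbove_eval {C : Set (X →L[ℝ] ℝ)} {c : ℝ} (hb : ∀ φ ∈ C, ‖φ‖ ≤ c) (x : X) :
    BddAbove ((fun φ : X →L[ℝ] ℝ => φ x) '' C) := by
  refine ⟨c * ‖x‖, ?_⟩
  rintro _ ⟨φ, hφ, rfl⟩
  exact (le_abs_self _).trans (φ.le_of_opNorm_le (hb φ hφ) x)

theorem le_supp {C : Set (X →L[ℝ] ℝ)} {c : ℝ} (hb : ∀ φ ∈ C, ‖φ‖ ≤ c) {φ : X →L[ℝ] ℝ}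
    (hφ : φ ∈ C) (x : X) : φ x ≤ supp x C :=
  le_csSup (bddAbove_eval hb x) (mem_image_of_mem _ hφ)

theorem supp_le {C : Set (X →L[ℝ] ℝ)} (hne : C.Nonempty) {x : X} {u : ℝ}
    (h : ∀ φ ∈ C, φ x ≤ u) : supp x C ≤ u := by
  refine csSup_le (hne.image _) ?_
  rintro _ ⟨φ, hφ, rfl⟩
  exact h φ hφ

theorem boundedSublinear_supp {C : Set (X →L[ℝ] ℝ)} {c : ℝ} (hne : C.Nonempty)
    (hb : ∀ φ ∈ C, ‖φ‖ ≤ c) : BoundedSublinear (fun x => supp x C) c where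
  add_le x y := supp_le hne fun φ hφ => by
    rw [map_add]
    exact add_le_add (le_supp hb hφ x) (le_supp hb hφ y)
  le_mul_norm x := supp_le hne fun φ hφ =>
    (le_abs_self _).trans (φ.le_of_opNorm_le (hb φ hφ) x)
  mul_le_nsmul m x := by
    rcases Nat.eq_zero_or_pos m with rfl | hm
    · obtain ⟨φ, hφ⟩ := hne
      simpa using le_supp hb hφ 0
    · have hm' : (0 : ℝ) < m := Nat.cast_pos.2 hm
      rw [← le_div_iff₀' hm']
      refine supp_le hne fun φ hφ => ?_
      rw [le_div_iff₀' hm', ← nsmul_eq_mul, ← map_nsmul]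
      exact le_supp hb hφ _

instance : LocallyConvexSpace ℝ (WeakDual ℝ X) :=
  inferInstanceAs (LocallyConvexSpace ℝ (WeakBilin (topDualPairing ℝ X)))

theorem exists_eval_eq_of_weakDual (L : StrongDual ℝ (WeakDual ℝ X)) : ∃ x : X, ∀ φ, L φ = φ x := by
  obtain ⟨x, hx⟩ := LinearMap.dualEmbedding_surjective (topDualPairing ℝ X) L
  exact ⟨x, fun φ => (DFunLike.congr_fun hx φ).symm⟩

theorem mem_wstarClosedConvexHull_iff {C : Set (X →L[ℝ] ℝ)} {c : ℝ} (hne : C.Nonempty)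
    (hb : ∀ φ ∈ C, ‖φ‖ ≤ c) {f : X →L[ℝ] ℝ} :
    f ∈ wstarClosedConvexHull C ↔ ∀ x, f x ≤ supp x C := by
  constructor
  · intro hf x
    have hcl : IsClosed {g : WeakDual ℝ X | g x ≤ supp x C} :=
      isClosed_le (WeakDual.eval_continuous x) continuous_const
    have hcv : Convex ℝ {g : WeakDual ℝ X | g x ≤ supp x C} :=
      convex_halfSpace_le (𝕜 := ℝ) (f := fun g : WeakDual ℝ X => g x)
        ⟨fun _ _ => rfl, fun _ _ => rfl⟩ _
    refine closure_minimal (convexHull_min ?_ hcv) hcl hf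
    rintro _ ⟨φ, hφ, rfl⟩
    exact le_supp hb hφ x
  · intro hf
    by_contra hmem
    obtain ⟨L, u, hL, hu⟩ := geometric_hahn_banach_closed_point
      (convex_convexHull ℝ (wstar '' C)).closure isClosed_closure hmem
    obtain ⟨x, hx⟩ := exists_eval_eq_of_weakDual L
    refine absurd (hf x) (not_le.2 (lt_of_le_of_lt (supp_le hne fun φ hφ => ?_) (hx _ ▸ hu)))
    have := hL (wstar φ) (subset_closure (subset_convexHull ℝ _ (mem_image_of_mem _ hφ)))
    rw [hx] at this
    exact this.le

theorem isCompact_closure_convexHull_wstar {C : Set (X →L[ℝ] ℝ)} {c : ℝ}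
    (hb : ∀ φ ∈ C, ‖φ‖ ≤ c) : IsCompact (closure (convexHull ℝ (wstar '' C))) := by
  have hball := WeakDual.isCompact_closedBall (𝕜 := ℝ) (E := X) 0 c
  refine hball.of_isClosed_subset isClosed_closure
    (closure_minimal (convexHull_min ?_ ?_) hball.isClosed)
  · rintro _ ⟨φ, hφ, rfl⟩
    exact mem_closedBall_zero_iff.2 (hb φ hφ)
  · exact (convex_closedBall (E := X →L[ℝ] ℝ) 0 c)

end SupportFunction

section Milman

variable {E : Type*} [AddCommGroup E] [Module ℝ E] [TopologicalSpace E]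
  [IsTopologicalAddGroup E] [ContinuousSMul ℝ E]

theorem isCompact_convexJoin {s t : Set E} (hs : IsCompact s) (ht : IsCompact t) :
    IsCompact (convexJoin ℝ s t) := by
  have h : convexJoin ℝ s t =
      (fun p : ℝ × E × E => AffineMap.lineMap p.2.1 p.2.2 p.1) '' (Icc 0 1 ×ˢ s ×ˢ t) := by
    ext x
    simp only [mem_convexJoin, segment_eq_image_lineMap, mem_image, mem_prod, Prod.exists]
    constructor
    · rintro ⟨a, ha, b, hb, r, hr, rfl⟩
      exact ⟨r, a, b, ⟨hr, ha, hb⟩, rfl⟩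
    · rintro ⟨r, a, b, ⟨hr, ha, hb⟩, rfl⟩
      exact ⟨a, ha, b, hb, r, hr, rfl⟩
  rw [h]
  refine (isCompact_Icc.prod (hs.prod ht)).image ?_
  simp only [AffineMap.lineMap_apply_module]
  fun_prop

theorem mem_or_mem_of_mem_extremePoints_closure_convexHull_union [T2Space E] {s t : Set E}
    (hs : IsCompact (closure (convexHull ℝ s))) (ht : IsCompact (closure (convexHull ℝ t)))
    {x : E} (hx : x ∈ (closure (convexHull ℝ (s ∪ t))).extremePoints ℝ) :
    x ∈ closure (convexHull ℝ s) ∨ x ∈ closure (convexHull ℝ t) := by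
  rcases s.eq_empty_or_nonempty with rfl | hsne
  · rw [empty_union] at hx
    exact Or.inr hx.1
  rcases t.eq_empty_or_nonempty with rfl | htne
  · rw [union_empty] at hx
    exact Or.inl hx.1
  have hsc := (convex_convexHull ℝ s).closure
  have htc := (convex_convexHull ℝ t).closure
  have hsub : closure (convexHull ℝ (s ∪ t)) ⊆
      convexJoin ℝ (closure (convexHull ℝ s)) (closure (convexHull ℝ t)) := by
    refine closure_minimal (convexHull_min (union_subset ?_ ?_) (hsc.convexJoin htc))
      (isCompact_convexJoin hs ht).isClosed
    · exact (subset_convexHull ℝ s).trans (subset_closure.trans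
        (subset_convexJoin_left (htne.mono ((subset_convexHull ℝ t).trans subset_closure))))
    · exact (subset_convexHull ℝ t).trans (subset_closure.trans
        (subset_convexJoin_right (hsne.mono ((subset_convexHull ℝ s).trans subset_closure))))
  obtain ⟨a, ha, b, hb, hab⟩ := mem_convexJoin.1 (hsub hx.1)
  have ha' := closure_mono (convexHull_mono (𝕜 := ℝ) (subset_union_left (t := t))) ha
  have hb' := closure_mono (convexHull_mono (𝕜 := ℝ) (subset_union_right (s := s))) hb
  rcases (mem_extremePoints_iff_forall_segment.1 hx).2 a ha' b hb' hab with rfl | rfl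
  · exact Or.inl ha
  · exact Or.inr hb

/-- **Milman's theorem**: extreme points of the closed convex hull of a compact set belong to the
set, provided that the closed convex hull is compact. -/
theorem extremePoints_closure_convexHull_subset [T2Space E] [LocallyConvexSpace ℝ E]
    {K : Set E}
    (hK : IsCompact K) (hKc : IsCompact (closure (convexHull ℝ K))) :
    (closure (convexHull ℝ K)).extremePoints ℝ ⊆ K := by
  intro x hx
  by_contra hxK
  have hcpt : ∀ s, IsCompact (closure (convexHull ℝ (s ∩ K))) := fun s =>
    hKc.of_isClosed_subset isClosed_closure
      (closure_mono (convexHull_mono inter_subset_right))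
  have key : x ∉ closure (convexHull ℝ (K ∩ K)) := by
    refine hK.induction_on (p := fun s => x ∉ closure (convexHull ℝ (s ∩ K))) (by simp) ?_ ?_ ?_
    · exact fun s t hst ht hs =>
        ht (closure_mono (convexHull_mono (inter_subset_inter_left K hst)) hs)
    · intro s t hs ht hst
      rw [union_inter_distrib_right] at hst
      have hext : x ∈ (closure (convexHull ℝ (s ∩ K ∪ t ∩ K))).extremePoints ℝ :=
        inter_extremePoints_subset_extremePoints_of_subset
          (closure_mono (convexHull_mono (union_subset inter_subset_right inter_subset_right)))
          ⟨hst, hx⟩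
      exact (mem_or_mem_of_mem_extremePoints_closure_convexHull_union (hcpt s) (hcpt t) hext).elim
        hs ht
    · intro y hy
      have hyx : y ≠ x := fun h => hxK (h ▸ hy)
      have : {x}ᶜ ∈ 𝓝 y := isOpen_compl_singleton.mem_nhds hyx
      obtain ⟨U, ⟨hU, hUc⟩, hUx⟩ := (closed_nhds_basis y).mem_iff.1 this
      obtain ⟨V, ⟨hV, hVc⟩, hVU⟩ := (LocallyConvexSpace.convex_basis (𝕜 := ℝ) y).mem_iff.1 hU
      refine ⟨V, mem_nhdsWithin_of_mem_nhds hV, fun h => ?_⟩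
      exact hUx (closure_minimal ((convexHull_min inter_subset_left hVc).trans hVU) hUc h) rfl
  rw [inter_self] at key
  exact key hx.1

end Milman

section ExtremeFunctionals

variable {X : Type u} [NormedAddCommGroup X] [NormedSpace ℝ X]

/-- A functional dominated by the support function of a weak*-closed bounded set `C` belongs to
`C` if it is not the midpoint of a nondegenerate segment of dominated functionals. -/
theorem mem_of_forall_add_sub_le_supp {C : Set (X →L[ℝ] ℝ)} {c : ℝ} (hne : C.Nonempty)
    (hcl : WStarClosed C) (hb : ∀ φ ∈ C, ‖φ‖ ≤ c) {f : X →L[ℝ] ℝ} (hf : ∀ x, f x ≤ supp x C)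
    (hext : ∀ h : X →L[ℝ] ℝ, (∀ x, f x + h x ≤ supp x C) → (∀ x, f x - h x ≤ supp x C) → h = 0) :
    f ∈ C := by
  have hKc := isCompact_closure_convexHull_wstar hb
  have hK : IsCompact (wstar '' C) := hKc.of_isClosed_subset hcl
    ((subset_convexHull ℝ _).trans subset_closure)
  suffices h : wstar f ∈ (closure (convexHull ℝ (wstar '' C))).extremePoints ℝ by
    obtain ⟨g, hg, hgf⟩ := extremePoints_closure_convexHull_subset hK hKc h
    exact (show g = f from hgf) ▸ hg
  refine ⟨(mem_wstarClosedConvexHull_iff hne hb).2 hf, ?_⟩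
  intro a ha b hb' ⟨s, t, hs, ht, hst, hfab⟩
  have ha' := (mem_wstarClosedConvexHull_iff (f := WeakDual.toStrongDual a) hne hb).1 ha
  have hb'' := (mem_wstarClosedConvexHull_iff (f := WeakDual.toStrongDual b) hne hb).1 hb'
  have hfx : ∀ x, f x = s * a x + t * b x := fun x => (DFunLike.congr_fun hfab x).symm
  have hzero := hext (min s t • (WeakDual.toStrongDual a - WeakDual.toStrongDual b))
  have hm0 : 0 < min s t := lt_min hs ht
  have hms := min_le_left s t
  have hmt := min_le_right s t
  have hS : ∀ u : ℝ, s * u + t * u = u := fun u => by rw [← add_mul, hst, one_mul]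
  have hz := hzero
    (fun x => by
      have h1 := ha' x
      have h2 := hb'' x
      simp only [WeakDual.toStrongDual_apply] at h1 h2
      simp only [smul_apply, sub_apply,
        WeakDual.toStrongDual_apply, smul_eq_mul, hfx]
      nlinarith [mul_nonneg (sub_nonneg.2 hmt) (sub_nonneg.2 h2),
        mul_nonneg (add_nonneg hs.le hm0.le) (sub_nonneg.2 h1), hS (supp x C)])
    (fun x => by
      have h1 := ha' x
      have h2 := hb'' x
      simp only [WeakDual.toStrongDual_apply] at h1 h2
      simp only [smul_apply, sub_apply,
        WeakDual.toStrongDual_apply, smul_eq_mul, hfx]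
      nlinarith [mul_nonneg (sub_nonneg.2 hms) (sub_nonneg.2 h1),
        mul_nonneg (add_nonneg ht.le hm0.le) (sub_nonneg.2 h2), hS (supp x C)])
  have hab : WeakDual.toStrongDual a = WeakDual.toStrongDual b :=
    sub_eq_zero.1 ((smul_eq_zero.1 hz).resolve_left hm0.ne')
  have hab' : a = b := hab
  subst hab'
  rw [← add_smul, hst, one_smul] at hfab
  exact hfab

end ExtremeFunctionals

section Density

variable {Ω : Type v} [MeasurableSpace Ω]

/-- Radon-Nikodym theorem for an additive set function dominated by an indefinite integral. -/
theorem exists_density_of_additive_of_le {μ : Measure Ω} [IsFiniteMeasure μ]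
    {F : {A : Set Ω // MeasurableSet A} → ℝ} {ψ : Ω → ℝ} (hψ : Integrable ψ μ)
    (hadd : ∀ A B, Disjoint A.1 B.1 → F ⟨A.1 ∪ B.1, A.2.union B.2⟩ = F A + F B)
    (hle : ∀ A, |F A| ≤ ∫ ω in A.1, ψ ω ∂μ) :
    ∃ f : Ω → ℝ, Measurable f ∧ Integrable f μ ∧ ∀ A, F A = ∫ ω in A.1, f ω ∂μ := by
  classical
  have hempty : F ⟨∅, MeasurableSet.empty⟩ = 0 := by
    have h := hadd ⟨∅, MeasurableSet.empty⟩ ⟨∅, MeasurableSet.empty⟩ (disjoint_empty _)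
    simp only [union_empty] at h
    linarith
  have hsum : ∀ (s : ℕ → Set Ω) (hs : ∀ i, MeasurableSet (s i)),
      Pairwise (Function.onFun Disjoint s) →
      HasSum (fun i => F ⟨s i, hs i⟩) (F ⟨⋃ i, s i, MeasurableSet.iUnion hs⟩) := by
    intro s hs hd
    have hψsum := hasSum_integral_iUnion hs hd (hψ.integrableOn (s := ⋃ i, s i))
    have hsummable : Summable fun i => F ⟨s i, hs i⟩ :=
      Summable.of_norm_bounded hψsum.summable fun i => hle ⟨s i, hs i⟩
    rw [hsummable.hasSum_iff_tendsto_nat]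
    have hmp : ∀ n, MeasurableSet (⋃ i ∈ Finset.range n, s i) := fun n =>
      Finset.measurableSet_biUnion _ fun i _ => hs i
    have hpart : ∀ n, F ⟨⋃ i ∈ Finset.range n, s i, hmp n⟩ =
        ∑ i ∈ Finset.range n, F ⟨s i, hs i⟩ := by
      intro n
      induction n with
      | zero => simpa using hempty
      | succ n ih =>
        rw [Finset.sum_range_succ, ← ih, ← hadd]
        · congr 2
          rw [Finset.range_add_one, Finset.set_biUnion_insert, union_comm]
        · simp only [disjoint_iUnion_left]
          exact fun i hi => hd (Finset.mem_range.1 hi).ne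
    have hψpart : ∀ n, ∫ ω in ⋃ i ∈ Finset.range n, s i, ψ ω ∂μ =
        ∑ i ∈ Finset.range n, ∫ ω in s i, ψ ω ∂μ := fun n =>
      integral_biUnion_finset _ (fun i _ => hs i) (fun i _ j _ hij => hd hij)
        fun i _ => hψ.integrableOn
    have hsub : ∀ n, ⋃ i ∈ Finset.range n, s i ⊆ ⋃ i, s i := fun n =>
      iUnion₂_subset fun i _ => subset_iUnion s i
    have hbound : ∀ n, ‖(∑ i ∈ Finset.range n, F ⟨s i, hs i⟩) -
        F ⟨⋃ i, s i, MeasurableSet.iUnion hs⟩‖ ≤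
        ∫ ω in ⋃ i, s i, ψ ω ∂μ - ∑ i ∈ Finset.range n, ∫ ω in s i, ψ ω ∂μ := by
      intro n
      have hm : MeasurableSet ((⋃ i, s i) \ ⋃ i ∈ Finset.range n, s i) :=
        (MeasurableSet.iUnion hs).diff (hmp n)
      have h1 := hadd ⟨_, hmp n⟩ ⟨_, hm⟩ disjoint_sdiff_right
      simp only [union_sdiff_cancel (hsub n)] at h1
      have h2 := hle ⟨_, hm⟩
      rw [setIntegral_sdiff (hmp n) hψ.integrableOn (hsub n), hψpart] at h2
      rw [h1, ← hpart, norm_sub_rev, add_sub_cancel_left]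
      exact h2
    rw [tendsto_iff_norm_sub_tendsto_zero]
    refine squeeze_zero (fun _ => norm_nonneg _) hbound ?_
    simpa using hψsum.tendsto_sum_nat.const_sub (∫ ω in ⋃ i, s i, ψ ω ∂μ)
  let σ : SignedMeasure Ω :=
    { measureOf' := fun A => if hA : MeasurableSet A then F ⟨A, hA⟩ else 0
      empty' := by simpa using hempty
      not_measurable' := fun A hA => dif_neg hA
      m_iUnion' := fun s hs hd => by
        simpa [hs, MeasurableSet.iUnion hs] using hsum s hs hd }
  have hσ : ∀ A : {A : Set Ω // MeasurableSet A}, σ A.1 = F A := fun A => dif_pos A.2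
  have hac : σ ≪ᵥ μ.toENNRealVectorMeasure := by
    refine VectorMeasure.AbsolutelyContinuous.mk fun A hA h0 => ?_
    rw [Measure.toENNRealVectorMeasure_apply_measurable hA] at h0
    have h := hle ⟨A, hA⟩
    rw [setIntegral_measure_zero _ h0] at h
    rw [hσ ⟨A, hA⟩]
    exact abs_nonpos_iff.1 h
  refine ⟨σ.rnDeriv μ, SignedMeasure.measurable_rnDeriv _ _, SignedMeasure.integrable_rnDeriv _ _,
    fun A => ?_⟩
  rw [← hσ A, ← withDensityᵥ_apply (SignedMeasure.integrable_rnDeriv _ _) A.2,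
    SignedMeasure.withDensityᵥ_rnDeriv_eq σ μ hac]

theorem norm_indicatorConstLp_one {μ : Measure Ω} [IsFiniteMeasure μ] {A : Set Ω}
    (hA : MeasurableSet A) :
    ‖indicatorConstLp 1 hA (measure_ne_top μ A) (1 : ℝ)‖ = μ.real A := by
  rw [norm_indicatorConstLp one_ne_zero ENNReal.one_ne_top]
  simp

/-- Continuous linear functionals on `L¹` of a finite measure are represented by essentially
bounded functions. -/
theorem exists_bounded_density_of_dual_L1 {μ : Measure Ω} [IsFiniteMeasure μ]
    (ℓ : StrongDual ℝ (Lp ℝ 1 μ)) :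
    ∃ g : Ω → ℝ, Measurable g ∧ (∀ ω, |g ω| ≤ ‖ℓ‖) ∧
      ∀ f : Lp ℝ 1 μ, ℓ f = ∫ ω, g ω * f ω ∂μ := by
  have hle : ∀ A : {A : Set Ω // MeasurableSet A},
      |ℓ (indicatorConstLp 1 A.2 (measure_ne_top μ A) 1)| ≤ ∫ _ in A.1, ‖ℓ‖ ∂μ := by
    intro A
    refine (ℓ.le_opNorm _).trans_eq ?_
    rw [norm_indicatorConstLp_one, setIntegral_const, smul_eq_mul, mul_comm]
  obtain ⟨g₀, hg₀m, hg₀i, hg₀⟩ := exists_density_of_additive_of_le (μ := μ)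
    (F := fun A => ℓ (indicatorConstLp 1 A.2 (measure_ne_top μ A) 1)) (integrable_const ‖ℓ‖)
    (fun A B hAB => by
      rw [← map_add, ← indicatorConstLp_disjoint_union A.2 B.2 _ _ hAB]) hle
  simp only [hg₀] at hle
  have hub : g₀ ≤ᵐ[μ] fun _ => ‖ℓ‖ :=
    ae_le_of_forall_setIntegral_le hg₀i (integrable_const _) fun A hA _ =>
      (le_abs_self _).trans (hle ⟨A, hA⟩)
  have hlb : (fun _ => -‖ℓ‖) ≤ᵐ[μ] g₀ :=
    ae_le_of_forall_setIntegral_le (integrable_const _) hg₀i fun A hA _ => by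
      rw [integral_neg]
      exact neg_le_of_abs_le (hle ⟨A, hA⟩)
  let g : Ω → ℝ := fun ω => max (-‖ℓ‖) (min ‖ℓ‖ (g₀ ω))
  have hgg₀ : g =ᵐ[μ] g₀ := by
    filter_upwards [hub, hlb] with ω h1 h2
    simp only [g]
    rw [min_eq_right h1, max_eq_right h2]
  have hgm : Measurable g := measurable_const.max (measurable_const.min hg₀m)
  have hgb : ∀ ω, |g ω| ≤ ‖ℓ‖ := fun ω => by
    have := norm_nonneg ℓ
    exact abs_le.2 ⟨le_max_left _ _, max_le (by linarith) (min_le_left _ _)⟩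
  have h_int : ∀ f : Ω → ℝ, Integrable f μ → Integrable (fun ω => g ω * f ω) μ := fun f hf =>
    hf.bdd_mul hgm.aestronglyMeasurable (ae_of_all _ hgb)
  refine ⟨g, hgm, hgb, fun f => ?_⟩
  have hfun : ∀ f : Ω → ℝ, ∀ hf : Integrable f μ, ℓ (hf.toL1 f) = ∫ ω, g ω * f ω ∂μ := by
    intro f hf
    refine Integrable.induction
      (P := fun f => ∀ hf : Integrable f μ, ℓ (hf.toL1 f) = ∫ ω, g ω * f ω ∂μ) ?_ ?_ ?_ ?_ hf hf
    · intro c A hA _ hf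
      have h : hf.toL1 _ = c • indicatorConstLp 1 hA (measure_ne_top μ A) (1 : ℝ) := by
        ext1
        filter_upwards [hf.coeFn_toL1, Lp.coeFn_smul c (indicatorConstLp 1 hA (measure_ne_top μ A)
          (1 : ℝ)), indicatorConstLp_coeFn (p := 1) (hs := hA) (hμs := measure_ne_top μ A)
          (c := (1 : ℝ))] with ω h1 h2 h3
        rw [h1, h2, Pi.smul_apply, h3]
        by_cases hω : ω ∈ A <;> simp [hω]
      rw [h, map_smul, hg₀ ⟨A, hA⟩, ← setIntegral_congr_ae hA (hgg₀.mono fun ω h _ => h),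
        smul_eq_mul, ← integral_const_mul, ← integral_indicator hA]
      refine integral_congr_ae (ae_of_all _ fun ω => ?_)
      by_cases hω : ω ∈ A <;> simp [hω, mul_comm]
    · intro f₁ f₂ _ h₁ h₂ e₁ e₂ h
      rw [Integrable.toL1_add _ _ h₁ h₂, map_add, e₁ h₁, e₂ h₂,
        ← integral_add (h_int _ h₁) (h_int _ h₂)]
      simp only [Pi.add_apply, mul_add]
    · have hcl : IsClosed {f : Lp ℝ 1 μ | ℓ f = ∫ ω, g ω * f ω ∂μ} := by
        refine isClosed_eq ℓ.continuous ?_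
        refine continuous_of_add_le (c := ‖ℓ‖) (fun f₁ f₂ => ?_) fun f => ?_
        · rw [← integral_add (h_int _ (L1.integrable_coeFn f₁)) (h_int _ (L1.integrable_coeFn f₂))]
          refine (integral_congr_ae ?_).le
          filter_upwards [Lp.coeFn_add f₁ f₂] with ω h
          rw [h, Pi.add_apply, mul_add]
        · rw [L1.norm_eq_integral_norm, ← integral_const_mul]
          refine integral_mono (h_int _ (L1.integrable_coeFn f))
            ((L1.integrable_coeFn f).norm.const_mul _) fun ω => ?_
          refine (le_abs_self _).trans ?_
          rw [abs_mul]
          exact mul_le_mul_of_nonneg_right (hgb ω) (abs_nonneg _)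
      convert hcl using 3 with f
      simp [L1.integrable_coeFn f]
    · intro f₁ f₂ h12 h₁ e₁ h₂
      rw [← (Integrable.toL1_eq_toL1_iff _ _ h₁ h₂).2 h12, e₁ h₁]
      exact integral_congr_ae (h12.mono fun ω h => by simp only [h])
  have := hfun f (L1.integrable_coeFn f)
  rwa [Integrable.toL1_coeFn] at this

end Density

section Annihilator

variable {X : Type u} [NormedAddCommGroup X] [NormedSpace ℝ X]
variable {Ω : Type v} [MeasurableSpace Ω]

theorem exists_ne_zero_forall_apply_eq_zero {E : Type*} [NormedAddCommGroup E] [NormedSpace ℝ E]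
    (T : X →L[ℝ] E) (hT : ¬ DenseRange T) : ∃ ℓ : StrongDual ℝ E, ℓ ≠ 0 ∧ ∀ x, ℓ (T x) = 0 := by
  rw [DenseRange, Dense] at hT
  push Not at hT
  obtain ⟨e, he⟩ := hT
  have hconv : Convex ℝ (closure (range T)) := by
    rw [← ContinuousLinearMap.coe_coe, ← LinearMap.coe_range]
    exact (LinearMap.range (T : X →ₗ[ℝ] E)).convex.closure
  obtain ⟨ℓ, u, h1, h2⟩ := geometric_hahn_banach_closed_point hconv isClosed_closure he
  have hlt : ∀ x, ℓ (T x) < u := fun x => h1 _ (subset_closure (mem_range_self x))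
  have h0 : 0 < u := by simpa using hlt 0
  have hzero : ∀ x, ℓ (T x) = 0 := by
    intro x
    by_contra h
    have := hlt ((u / ℓ (T x)) • x)
    rw [map_smul, map_smul, smul_eq_mul, div_mul_cancel₀ _ h] at this
    exact lt_irrefl _ this
  refine ⟨ℓ, ?_, hzero⟩
  rintro rfl
  simp only [zero_apply] at h2
  linarith

/-- On a set over which `L¹` is nonseparable, every integrably bounded weak*-scalarly measurable
function has a nontrivial bounded annihilator. -/
theorem exists_annihilator [TopologicalSpace.SeparableSpace X] {μ : Measure Ω} [IsFiniteMeasure μ]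
    {A : Set Ω} (hA : ¬ TopologicalSpace.SeparableSpace (Lp ℝ 1 (μ.restrict A)))
    {ψ : Ω → ℝ} (hψ : Integrable ψ μ) {h : Ω → X →L[ℝ] ℝ}
    (hm : ∀ x, Measurable fun ω => h ω x) (hle : ∀ ω x, |h ω x| ≤ ψ ω * ‖x‖) :
    ∃ φ : Ω → ℝ, Measurable φ ∧ (∀ ω, |φ ω| ≤ 1) ∧ ¬ φ =ᵐ[μ.restrict A] 0 ∧
      ∀ x, ∫ ω in A, φ ω * h ω x ∂μ = 0 := by
  have h_int : ∀ x, Integrable (fun ω => h ω x) (μ.restrict A) := fun x =>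
    (hψ.restrict.mul_const ‖x‖).mono' (hm x).aestronglyMeasurable (ae_of_all _ fun ω => hle ω x)
  let T : X →L[ℝ] Lp ℝ 1 (μ.restrict A) := LinearMap.mkContinuous
    { toFun := fun x => (h_int x).toL1 _
      map_add' := fun x y => by
        rw [← Integrable.toL1_add, Integrable.toL1_eq_toL1_iff]
        exact ae_of_all _ fun ω => map_add _ _ _
      map_smul' := fun c x => by
        rw [RingHom.id_apply, ← Integrable.toL1_smul, Integrable.toL1_eq_toL1_iff]
        exact ae_of_all _ fun ω => map_smul _ _ _ }
    (∫ ω in A, ψ ω ∂μ) fun x => by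
      rw [LinearMap.coe_mk, AddHom.coe_mk, L1.norm_of_fun_eq_integral_norm, ← integral_mul_const]
      exact integral_mono (h_int x).norm (hψ.restrict.mul_const ‖x‖) fun ω => hle ω x
  have hTx : ∀ x, T x =ᵐ[μ.restrict A] fun ω => h ω x := fun x => (h_int x).coeFn_toL1
  obtain ⟨ℓ, hℓ, hℓT⟩ := exists_ne_zero_forall_apply_eq_zero T
    fun hd => hA (hd.separableSpace T.continuous)
  obtain ⟨g, hgm, hgb, hg⟩ := exists_bounded_density_of_dual_L1 ℓ
  have hpos : 0 < ‖ℓ‖ := norm_pos_iff.2 hℓ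
  refine ⟨fun ω => g ω / ‖ℓ‖, hgm.div_const _, fun ω => ?_, fun h0 => hℓ ?_, fun x => ?_⟩
  · rw [abs_div, abs_norm, div_le_one hpos]
    exact hgb ω
  · ext f
    rw [hg, zero_apply]
    refine integral_eq_zero_of_ae (h0.mono fun ω h => ?_)
    simp only [Pi.zero_apply, div_eq_zero_iff, hpos.ne', or_false] at h
    simp [h]
  · have hx : ∫ ω in A, g ω * h ω x ∂μ = 0 := by
      rw [← hℓT x, hg]
      exact integral_congr_ae ((hTx x).mono fun ω h => by simp only [h])
    simp only [div_mul_eq_mul_div, integral_div, hx, zero_div]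

end Annihilator

section SetFunctions

variable {X : Type u} [NormedAddCommGroup X]
variable {Ω : Type v} [MeasurableSpace Ω]

theorem BoundedSublinear.apply_zero {p : X → ℝ} {c : ℝ} (hp : BoundedSublinear p c) : p 0 = 0 :=
  le_antisymm (by simpa using hp.le_mul_norm 0) hp.zero_nonneg

theorem BoundedSublinear.abs_le {p : X → ℝ} {c : ℝ} (hp : BoundedSublinear p c) (x : X) :
    |p x| ≤ c * ‖x‖ :=
  _root_.abs_le.2 ⟨neg_le_of_add_le hp.add_le hp.le_mul_norm x, hp.le_mul_norm x⟩

/-- Additive functionals on a dense subgroup dominated by `p` extend to continuous linear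
functionals dominated by `p`. -/
theorem BoundedSublinear.exists_clm_extension [NormedSpace ℝ X] {p : X → ℝ} {c : ℝ}
    (hp : BoundedSublinear p c) {D : Submodule ℤ X} (hD : Dense (D : Set X)) {f : X → ℝ}
    (hadd : ∀ d ∈ D, ∀ e ∈ D, f (d + e) = f d + f e) (hle : ∀ d ∈ D, f d ≤ p d) :
    ∃ φ : X →L[ℝ] ℝ, (∀ d ∈ D, φ d = f d) ∧ ∀ x, φ x ≤ p x := by
  have hf0 : f 0 = 0 := by
    have := hadd 0 D.zero_mem 0 D.zero_mem
    rw [add_zero] at this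
    linarith
  have hneg : ∀ d ∈ D, f d + f (-d) = 0 := fun d hd => by
    rw [← hadd d hd _ (D.neg_mem hd), add_neg_cancel, hf0]
  have hbdd : ∀ x, BddBelow (range fun d : D => f d + p (x - d)) := by
    refine fun x => ⟨-p (-x), ?_⟩
    rintro _ ⟨⟨d, hd⟩, rfl⟩
    have h1 := hneg d hd
    have h2 := hle _ (D.neg_mem hd)
    have h3 := hp.add_le (-x) (x - d)
    rw [← add_sub_assoc, neg_add_cancel, zero_sub] at h3
    dsimp only
    linarith
  let q : X → ℝ := fun x => ⨅ d : D, f d + p (x - d)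
  have hqle : ∀ x, ∀ d ∈ D, q x ≤ f d + p (x - d) := fun x d hd => ciInf_le (hbdd x) ⟨d, hd⟩
  have hqp : ∀ x, q x ≤ p x := fun x => by simpa [hf0] using hqle x 0 D.zero_mem
  have hqf : ∀ d ∈ D, q d = f d := by
    refine fun d hd => le_antisymm ?_ (le_ciInf ?_)
    · simpa [hp.apply_zero] using hqle d d hd
    · rintro ⟨e, he⟩
      have h1 := hadd e he (d - e) (D.sub_mem hd he)
      rw [add_sub_cancel] at h1
      rw [h1]
      linarith [hle _ (D.sub_mem hd he)]
  have hqadd : ∀ x y, q (x + y) ≤ q x + q y := by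
    refine fun x y => le_ciInf_add_ciInf ?_
    rintro ⟨d, hd⟩ ⟨e, he⟩
    have h1 := hqle (x + y) (d + e) (D.add_mem hd he)
    have h2 := hp.add_le (x - d) (y - e)
    rw [hadd d hd e he, add_sub_add_comm] at h1
    dsimp only
    linarith
  obtain ⟨φ, hφ⟩ := exists_clm_of_odd_on_dense hqadd (fun x => (hqp x).trans (hp.le_mul_norm x)) hD
    fun d hd => by
      rw [hqf d hd, hqf _ (D.neg_mem hd), hneg d hd]
  exact ⟨φ, fun d hd => (hφ d).trans (hqf d hd), fun x => (hφ x).trans_le (hqp x)⟩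

/-- Finitely additive set functions, additive in the vector variable, which are dominated by the
indefinite integral of `s`. -/
structure IsDominated (μ : Measure Ω) (s : Ω → X → ℝ)
    (F : {A : Set Ω // MeasurableSet A} → X → ℝ) : Prop where
  map_add : ∀ A x y, F A (x + y) = F A x + F A y
  map_union : ∀ A B : {A : Set Ω // MeasurableSet A}, Disjoint A.1 B.1 →
    ∀ x, F ⟨A.1 ∪ B.1, A.2.union B.2⟩ x = F A x + F B x
  le_integral : ∀ A x, F A x ≤ ∫ ω in A.1, s ω x ∂μ

variable {μ : Measure Ω} {s : Ω → X → ℝ} {ψ : Ω → ℝ}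

theorem integrable_of_boundedSublinear (hψ : Integrable ψ μ)
    (hs : ∀ ω, BoundedSublinear (s ω) (ψ ω)) (hsm : ∀ x, Measurable fun ω => s ω x) (x : X) :
    Integrable (fun ω => s ω x) μ :=
  (hψ.mul_const ‖x‖).mono' (hsm x).aestronglyMeasurable (ae_of_all _ fun ω => (hs ω).abs_le x)

theorem BoundedSublinear.of_le [NormedSpace ℝ X] {p : X → ℝ} {c : ℝ} (hp : BoundedSublinear p c)
    {φ : X →L[ℝ] ℝ} (h : ∀ x, φ x ≤ p x) : BoundedSublinear φ c where
  add_le x y := (map_add φ x y).le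
  le_mul_norm x := (h x).trans (hp.le_mul_norm x)
  mul_le_nsmul m x := by simp

theorem IsDominated.setIntegral_of_le [NormedSpace ℝ X] (hψ : Integrable ψ μ)
    (hs : ∀ ω, BoundedSublinear (s ω) (ψ ω)) (hsm : ∀ x, Measurable fun ω => s ω x)
    {f : Ω → X →L[ℝ] ℝ} (hf : ∀ x, Integrable (fun ω => f ω x) μ)
    (hle : ∀ x, (fun ω => f ω x) ≤ᵐ[μ] fun ω => s ω x) :
    IsDominated μ s fun A x => ∫ ω in A.1, f ω x ∂μ where
  map_add A x y := by
    simp only [_root_.map_add]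
    exact integral_add (hf x).restrict (hf y).restrict
  map_union A B hAB x := setIntegral_union hAB B.2 (hf x).integrableOn (hf x).integrableOn
  le_integral A x := setIntegral_mono_ae (hf x).integrableOn
    (integrable_of_boundedSublinear hψ hs hsm x).integrableOn (hle x)

theorem IsDominated.abs_le {F : {A : Set Ω // MeasurableSet A} → X → ℝ} (hF : IsDominated μ s F)
    (hψ : Integrable ψ μ) (hs : ∀ ω, BoundedSublinear (s ω) (ψ ω))
    (hsm : ∀ x, Measurable fun ω => s ω x) (A : {A : Set Ω // MeasurableSet A}) (x : X) :
    |F A x| ≤ ∫ ω in A.1, ψ ω * ‖x‖ ∂μ := by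
  have h : ∀ y, F A y ≤ ∫ ω in A.1, ψ ω * ‖y‖ ∂μ := fun y =>
    (hF.le_integral A y).trans <| integral_mono
      (integrable_of_boundedSublinear hψ hs hsm y).restrict (hψ.restrict.mul_const ‖y‖)
      fun ω => (hs ω).le_mul_norm y
  have h0 : F A 0 = 0 := by simpa using hF.map_add A 0 0
  have h1 := hF.map_add A x (-x)
  have h2 := h (-x)
  rw [norm_neg] at h2
  rw [add_neg_cancel, h0] at h1
  exact _root_.abs_le.2 ⟨by linarith, h x⟩

/-- Dominated additive set functions have a weak*-scalarly measurable density. -/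
theorem IsDominated.exists_density [NormedSpace ℝ X] [TopologicalSpace.SeparableSpace X]
    [IsFiniteMeasure μ] {F : {A : Set Ω // MeasurableSet A} → X → ℝ} (hF : IsDominated μ s F)
    (hψ : Integrable ψ μ) (hs : ∀ ω, BoundedSublinear (s ω) (ψ ω))
    (hsm : ∀ x, Measurable fun ω => s ω x) :
    ∃ f : Ω → X →L[ℝ] ℝ, (∀ x, Measurable fun ω => f ω x) ∧ (∀ ω x, f ω x ≤ s ω x) ∧
      ∀ A x, F A x = ∫ ω in A.1, f ω x ∂μ := by
  classical
  have hden : ∀ x, ∃ f : Ω → ℝ, Measurable f ∧ Integrable f μ ∧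
      ∀ A, F A x = ∫ ω in A.1, f ω ∂μ := fun x =>
    exists_density_of_additive_of_le (hψ.mul_const ‖x‖) (fun A B hAB => hF.map_union A B hAB x)
      fun A => hF.abs_le hψ hs hsm A x
  choose f hfm hfi hf using hden
  let D : Submodule ℤ X := Submodule.span ℤ (range (TopologicalSpace.denseSeq X))
  have hD : Dense (D : Set X) :=
    (TopologicalSpace.denseRange_denseSeq X).mono Submodule.subset_span
  have hadd : ∀ᵐ ω ∂μ, ∀ d e : D, f (d + e) ω = f d ω + f e ω := by
    refine ae_all_iff.2 fun d => ae_all_iff.2 fun e =>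
      Integrable.ae_eq_of_forall_setIntegral_eq _ _ (hfi _) ((hfi d).add (hfi e)) fun A hA _ => ?_
    rw [← hf _ ⟨A, hA⟩, hF.map_add, hf _ ⟨A, hA⟩, hf _ ⟨A, hA⟩]
    exact (integral_add (hfi d).restrict (hfi e).restrict).symm
  have hle : ∀ᵐ ω ∂μ, ∀ d : D, f d ω ≤ s ω d := by
    refine ae_all_iff.2 fun d => ae_le_of_forall_setIntegral_le (hfi _)
      (integrable_of_boundedSublinear hψ hs hsm d) fun A hA _ => ?_
    rw [← hf _ ⟨A, hA⟩]
    exact hF.le_integral ⟨A, hA⟩ d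
  let N : Set Ω := toMeasurable μ
    {ω | ¬ ((∀ d e : D, f (d + e) ω = f d ω + f e ω) ∧ ∀ d : D, f d ω ≤ s ω d)}
  have hNm : MeasurableSet N := measurableSet_toMeasurable _ _
  have hN0 : μ N = 0 := by
    rw [measure_toMeasurable]
    exact hadd.and hle
  have hN : ∀ ω ∉ N, (∀ d e : D, f (d + e) ω = f d ω + f e ω) ∧ ∀ d : D, f d ω ≤ s ω d := by
    intro ω hω
    by_contra h
    exact hω (subset_toMeasurable _ _ h)
  obtain ⟨σ, hσm, hσ, -⟩ := exists_measurable_selection hs hsm 0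
  have hφ : ∀ ω, ∃ φ : X →L[ℝ] ℝ, (ω ∉ N → ∀ d ∈ D, φ d = f d ω) ∧ (ω ∈ N → φ = σ ω) ∧
      ∀ x, φ x ≤ s ω x := by
    intro ω
    by_cases hω : ω ∈ N
    · exact ⟨σ ω, fun h => absurd hω h, fun _ => rfl, hσ ω⟩
    · obtain ⟨φ, h1, h2⟩ := (hs ω).exists_clm_extension hD (f := fun x => f x ω)
        (fun d hd e he => (hN ω hω).1 ⟨d, hd⟩ ⟨e, he⟩) fun d hd => (hN ω hω).2 ⟨d, hd⟩
      exact ⟨φ, fun _ => h1, fun h => absurd h hω, h2⟩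
  choose φ hφf hφσ hφs using hφ
  have hφD : ∀ d ∈ D, Measurable fun ω => φ ω d := by
    intro d hd
    have : (fun ω => φ ω d) = N.piecewise (fun ω => σ ω d) (f d) := by
      ext ω
      by_cases hω : ω ∈ N
      · simp [hω, hφσ ω hω]
      · simp [hω, hφf ω hω d hd]
    rw [this]
    exact (hσm d).piecewise hNm (hfm d)
  have hφm : ∀ x, Measurable fun ω => φ ω x := by
    intro x
    obtain ⟨u, hu, hux⟩ := mem_closure_iff_seq_limit.1 (hD x)
    refine measurable_of_tendsto_metrizable (fun n => hφD (u n) (hu n)) ?_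
    exact tendsto_pi_nhds.2 fun ω => ((φ ω).continuous.tendsto x).comp hux
  have hφi : ∀ x, Integrable (fun ω => φ ω x) μ :=
    integrable_of_boundedSublinear hψ (fun ω => (hs ω).of_le (hφs ω)) hφm
  have hdom := IsDominated.setIntegral_of_le hψ hs hsm hφi fun x => ae_of_all _ fun ω => hφs ω x
  have hcont : ∀ {G : {A : Set Ω // MeasurableSet A} → X → ℝ}, IsDominated μ s G →
      ∀ A, Continuous (G A) := fun hG A =>
    continuous_of_add_le (c := ∫ ω in A.1, ψ ω ∂μ) (fun x y => (hG.map_add A x y).le) fun x =>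
      ((le_abs_self _).trans (hG.abs_le hψ hs hsm A x)).trans_eq (integral_mul_const _ _)
  refine ⟨φ, hφm, hφs, fun A => congrFun ?_⟩
  refine (hcont hF A).ext_on hD (hcont hdom A) fun d hd => ?_
  rw [hf]
  refine integral_congr_ae (ae_restrict_of_ae ?_)
  have hNae : ∀ᵐ ω ∂μ, ω ∉ N := measure_eq_zero_iff_ae_notMem.1 hN0
  filter_upwards [hNae] with ω hω
  exact (hφf ω hω d hd).symm

theorem convex_setOf_isDominated :
    Convex ℝ {F | IsDominated μ s F} := by
  rw [convex_iff_forall_pos]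
  intro F hF G hG a b ha hb hab
  refine ⟨fun A x y => ?_, fun A B hAB x => ?_, fun A x => ?_⟩
  · simp only [Pi.add_apply, Pi.smul_apply, smul_eq_mul, hF.map_add, hG.map_add]
    ring
  · simp only [Pi.add_apply, Pi.smul_apply, smul_eq_mul, hF.map_union A B hAB,
      hG.map_union A B hAB]
    ring
  · simp only [Pi.add_apply, Pi.smul_apply, smul_eq_mul]
    have h1 := mul_le_mul_of_nonneg_left (hF.le_integral A x) ha.le
    have h2 := mul_le_mul_of_nonneg_left (hG.le_integral A x) hb.le
    have h3 : a * ∫ ω in A.1, s ω x ∂μ + b * ∫ ω in A.1, s ω x ∂μ = ∫ ω in A.1, s ω x ∂μ := by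
      rw [← add_mul, hab, one_mul]
    linarith

theorem isCompact_setOf_isDominated (hψ : Integrable ψ μ)
    (hs : ∀ ω, BoundedSublinear (s ω) (ψ ω)) (hsm : ∀ x, Measurable fun ω => s ω x) :
    IsCompact {F | IsDominated μ s F} := by
  have hK : IsCompact (univ.pi fun A : {A : Set Ω // MeasurableSet A} => univ.pi fun x : X =>
      Icc (-∫ ω in A.1, ψ ω * ‖x‖ ∂μ) (∫ ω in A.1, ψ ω * ‖x‖ ∂μ)) :=
    isCompact_univ_pi fun A => isCompact_univ_pi fun x => isCompact_Icc
  refine hK.of_isClosed_subset ?_ fun F hF A _ x _ =>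
    _root_.abs_le.1 (hF.abs_le hψ hs hsm A x)
  have hc : ∀ (A : {A : Set Ω // MeasurableSet A}) (x : X),
      Continuous fun F : {A : Set Ω // MeasurableSet A} → X → ℝ => F A x := fun A x =>
    (continuous_apply x).comp (continuous_apply A)
  have heq : {F | IsDominated μ s F} = (⋂ (A) (x) (y), {F | F A (x + y) = F A x + F A y}) ∩
      (⋂ (A : {A : Set Ω // MeasurableSet A}) (B : {A : Set Ω // MeasurableSet A})
        (_ : Disjoint A.1 B.1) (x),
        {F | F ⟨A.1 ∪ B.1, A.2.union B.2⟩ x = F A x + F B x}) ∩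
      ⋂ (A) (x), {F | F A x ≤ ∫ ω in A.1, s ω x ∂μ} := by
    ext F
    simp only [mem_inter_iff, mem_iInter, mem_ofPred_eq]
    exact ⟨fun h => ⟨⟨h.map_add, h.map_union⟩, h.le_integral⟩, fun h => ⟨h.1.1, h.1.2, h.2⟩⟩
  rw [heq]
  refine ((isClosed_iInter fun A => isClosed_iInter fun x => isClosed_iInter fun y => ?_).inter
    (isClosed_iInter fun A => isClosed_iInter fun B => isClosed_iInter fun _ =>
      isClosed_iInter fun x => ?_)).inter (isClosed_iInter fun A => isClosed_iInter fun x => ?_)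
  · exact isClosed_eq (hc _ _) ((hc _ _).add (hc _ _))
  · exact isClosed_eq (hc _ _) ((hc _ _).add (hc _ _))
  · exact isClosed_le (hc _ _) continuous_const

end SetFunctions

section Extremal

variable {X : Type u} [NormedAddCommGroup X] [NormedSpace ℝ X]
variable {Ω : Type v} [MeasurableSpace Ω]

/-- The infimal convolution of `x ↦ p x - f x` and its reflection. It is the support function of
the set of all `h` such that `f + h` and `f - h` are dominated by `p`. -/
def pinching (p : X → ℝ) (f : X →L[ℝ] ℝ) (x : X) : ℝ :=
  ⨅ y : X, (p y - f y) + (p (y - x) - f (y - x))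

variable {p : X → ℝ} {c : ℝ} {f : X →L[ℝ] ℝ}

theorem bddBelow_pinching (hf : ∀ x, f x ≤ p x) (x : X) :
    BddBelow (range fun y : X => (p y - f y) + (p (y - x) - f (y - x))) := by
  refine ⟨0, ?_⟩
  rintro _ ⟨y, rfl⟩
  exact add_nonneg (sub_nonneg.2 (hf _)) (sub_nonneg.2 (hf _))

theorem pinching_nonneg (hf : ∀ x, f x ≤ p x) (x : X) : 0 ≤ pinching p f x :=
  Real.iInf_nonneg fun _ => add_nonneg (sub_nonneg.2 (hf _)) (sub_nonneg.2 (hf _))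

theorem pinching_le (hf : ∀ x, f x ≤ p x) (x y : X) :
    pinching p f x ≤ (p y - f y) + (p (y - x) - f (y - x)) :=
  ciInf_le (bddBelow_pinching hf x) y

theorem pinching_le_sub (hp : BoundedSublinear p c) (hf : ∀ x, f x ≤ p x) (x : X) :
    pinching p f x ≤ p x - f x := by
  simpa [hp.apply_zero] using pinching_le hf x x

theorem pinching_neg_le_sub (hp : BoundedSublinear p c) (hf : ∀ x, f x ≤ p x) (x : X) :
    pinching p f (-x) ≤ p x - f x := by
  simpa [hp.apply_zero] using pinching_le hf (-x) 0

theorem le_pinching {h : X →L[ℝ] ℝ} (h₁ : ∀ x, f x + h x ≤ p x) (h₂ : ∀ x, f x - h x ≤ p x)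
    (x : X) : h x ≤ pinching p f x := by
  refine le_ciInf fun y => ?_
  have := h₁ y
  have := h₂ (y - x)
  have := map_sub h y x
  linarith

theorem boundedSublinear_pinching (hp : BoundedSublinear p c) (hf : ∀ x, f x ≤ p x) :
    BoundedSublinear (pinching p f) (2 * c) where
  add_le x x' := by
    refine le_ciInf_add_ciInf fun y y' => ?_
    have h := pinching_le hf (x + x') (y + y')
    have h1 := hp.add_le y y'
    have h2 := hp.add_le (y - x) (y' - x')
    rw [add_sub_add_comm, map_add, map_add] at h
    linarith
  le_mul_norm x := by
    have h1 := hp.le_mul_norm x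
    have h2 := (hp.of_le hf).abs_le x
    have h3 := neg_le_of_abs_le h2
    linarith [pinching_le_sub hp hf x]
  mul_le_nsmul m x := by
    rcases Nat.eq_zero_or_pos m with rfl | hm
    · simpa using pinching_nonneg hf 0
    have hm' : (m : ℝ) ≠ 0 := by positivity
    refine le_ciInf fun y => ?_
    have hy : m • ((m : ℝ)⁻¹ • y) = y := by
      rw [← Nat.cast_smul_eq_nsmul ℝ, smul_inv_smul₀ hm']
    have h := mul_le_mul_of_nonneg_left (pinching_le hf x ((m : ℝ)⁻¹ • y)) (Nat.cast_nonneg m)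
    have h1 := hp.mul_le_nsmul m ((m : ℝ)⁻¹ • y)
    have h2 := hp.mul_le_nsmul m ((m : ℝ)⁻¹ • y - x)
    have h3 := map_nsmul f m ((m : ℝ)⁻¹ • y)
    have h4 := map_nsmul f m ((m : ℝ)⁻¹ • y - x)
    rw [nsmul_eq_mul] at h3 h4
    rw [nsmul_sub, hy] at h2 h4
    rw [hy] at h1 h3
    linarith

theorem measurable_pinching [TopologicalSpace.SeparableSpace X] {s : Ω → X → ℝ} {ψ : Ω → ℝ}
    (hs : ∀ ω, BoundedSublinear (s ω) (ψ ω)) (hsm : ∀ x, Measurable fun ω => s ω x)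
    {f : Ω → X →L[ℝ] ℝ} (hfm : ∀ x, Measurable fun ω => f ω x) (x : X) :
    Measurable fun ω => pinching (s ω) (f ω) x := by
  have h : ∀ ω, pinching (s ω) (f ω) x = ⨅ y : range (TopologicalSpace.denseSeq X),
      (s ω y - f ω y) + (s ω (y - x) - f ω (y - x)) := by
    intro ω
    have hsc := (hs ω).continuous
    have hfc := (f ω).continuous
    have hc : Continuous fun y => (s ω y - f ω y) + (s ω (y - x) - f ω (y - x)) := by fun_prop
    exact (Dense.ciInf' (TopologicalSpace.denseRange_denseSeq X) hc).symm
  have : Countable (range (TopologicalSpace.denseSeq X)) := (countable_range _).to_subtype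
  simp only [h]
  exact Measurable.iInf fun y =>
    ((hsm _).sub (hfm _)).add ((hsm _).sub (hfm _))

/-- Densities of extreme points are almost everywhere extreme. -/
theorem ae_eq_zero_of_mem_extremePoints [TopologicalSpace.SeparableSpace X] {μ : Measure Ω}
    [IsFiniteMeasure μ] (hsat : Saturated μ) {s : Ω → X → ℝ} {ψ : Ω → ℝ} (hψ : Integrable ψ μ)
    (hs : ∀ ω, BoundedSublinear (s ω) (ψ ω)) (hsm : ∀ x, Measurable fun ω => s ω x)
    {f : Ω → X →L[ℝ] ℝ} (hfm : ∀ x, Measurable fun ω => f ω x) (hf : ∀ ω x, f ω x ≤ s ω x)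
    {g : X → ℝ} (hext : (fun (A : {A : Set Ω // MeasurableSet A}) x => ∫ ω in A.1, f ω x ∂μ) ∈
      extremePoints ℝ {F | IsDominated μ s F ∧ F ⟨univ, MeasurableSet.univ⟩ = g}) :
    ∀ᵐ ω ∂μ, ∀ h : X →L[ℝ] ℝ, (∀ x, f ω x + h x ≤ s ω x) → (∀ x, f ω x - h x ≤ s ω x) →
      h = 0 := by
  have hqm := measurable_pinching hs hsm hfm
  have hfi : ∀ x, Integrable (fun ω => f ω x) μ :=
    integrable_of_boundedSublinear hψ (fun ω => (hs ω).of_le (hf ω)) hfm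
  have hq0 : ∀ x₀, ∀ᵐ ω ∂μ, pinching (s ω) (f ω) x₀ ≤ 0 := by
    intro x₀
    let A : Set Ω := {ω | 0 < pinching (s ω) (f ω) x₀}
    have hA : MeasurableSet A := measurableSet_lt measurable_const (hqm x₀)
    suffices μ A = 0 by
      filter_upwards [measure_eq_zero_iff_ae_notMem.1 this] with ω hω using not_lt.1 hω
    by_contra hA0
    obtain ⟨h, hm, hle, hx₀⟩ := exists_measurable_selection
      (fun ω => boundedSublinear_pinching (hs ω) (hf ω)) hqm x₀
    have hh : ∀ ω x, |h ω x| ≤ s ω x - f ω x := by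
      refine fun ω x => abs_le'.2 ⟨(hle ω x).trans (pinching_le_sub (hs ω) (hf ω) x), ?_⟩
      rw [← map_neg]
      exact (hle ω (-x)).trans (pinching_neg_le_sub (hs ω) (hf ω) x)
    have hψ2 : Integrable (fun ω => 2 * ψ ω) μ := hψ.const_mul 2
    obtain ⟨φ, hφm, hφ1, hφ0, hφ⟩ := exists_annihilator
      (hsat A hA (pos_iff_ne_zero.2 hA0)) hψ2 hm fun ω =>
        ((boundedSublinear_pinching (hs ω) (hf ω)).of_le (hle ω)).abs_le
    let t : Ω → ℝ := A.indicator φ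
    have htm : Measurable t := hφm.indicator hA
    have ht1 : ∀ ω, |t ω| ≤ 1 := by
      intro ω
      by_cases hω : ω ∈ A
      · simpa [t, hω] using hφ1 ω
      · simp [t, hω]
    have hth : ∀ ω x, |t ω * h ω x| ≤ s ω x - f ω x := by
      intro ω x
      rw [abs_mul]
      exact (mul_le_of_le_one_left (abs_nonneg _) (ht1 ω)).trans (hh ω x)
    have hthi : ∀ x, Integrable (fun ω => t ω * h ω x) μ := fun x =>
      ((integrable_of_boundedSublinear hψ hs hsm x).sub (hfi x)).mono'
        (htm.mul (hm x)).aestronglyMeasurable (ae_of_all _ fun ω => hth ω x)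
    have hth0 : ∀ x, ∫ ω, t ω * h ω x ∂μ = 0 := by
      intro x
      rw [← hφ x, ← integral_indicator hA]
      refine integral_congr_ae (ae_of_all _ fun ω => ?_)
      by_cases hω : ω ∈ A <;> simp [t, hω]
    have hmem : ∀ ε : ℝ, |ε| = 1 →
        (fun (B : {B : Set Ω // MeasurableSet B}) x =>
          ∫ ω in B.1, (f ω + (ε * t ω) • h ω) x ∂μ) ∈
        {F | IsDominated μ s F ∧ F ⟨univ, MeasurableSet.univ⟩ = g} := by
      intro ε hε
      have happ : ∀ ω x, (f ω + (ε * t ω) • h ω) x = f ω x + ε * (t ω * h ω x) := fun ω x => by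
        simp [mul_assoc]
      refine ⟨IsDominated.setIntegral_of_le hψ hs hsm (fun x => ?_)
        fun x => ae_of_all _ fun ω => ?_, ?_⟩
      · simp only [happ]
        exact (hfi x).add ((hthi x).const_mul ε)
      · have h1 : ε * (t ω * h ω x) ≤ s ω x - f ω x :=
          (le_abs_self _).trans (by rw [abs_mul, hε, one_mul]; exact hth ω x)
        simp only [happ]
        linarith
      · rw [← hext.1.2]
        ext x
        simp only [happ, Measure.restrict_univ]
        rw [integral_add (hfi x) ((hthi x).const_mul ε), integral_const_mul, hth0, mul_zero,
          add_zero]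
    have heq := (mem_extremePoints.1 hext).2 _ (hmem 1 (by simp)) _ (hmem (-1) (by simp))
      ⟨1 / 2, 1 / 2, by norm_num, by norm_num, by norm_num, by
        ext B x
        have h1 := (hfi x).restrict (s := B.1)
        have h2 := (hthi x).restrict (s := B.1)
        simp only [Pi.add_apply, Pi.smul_apply, smul_eq_mul, add_apply, smul_apply, one_mul,
          neg_mul, ← sub_eq_add_neg]
        rw [integral_add h1 h2, integral_sub h1 h2]
        ring⟩
    have hae : (fun ω => t ω * h ω x₀) =ᵐ[μ] fun _ => 0 := by
      refine Integrable.ae_eq_of_forall_setIntegral_eq _ _ (hthi x₀) (integrable_zero _ _ _)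
        fun B hB _ => ?_
      have h1 := congrFun (congrFun heq.1 ⟨B, hB⟩) x₀
      simp only [add_apply, smul_apply, smul_eq_mul, one_mul] at h1
      rw [integral_add (hfi x₀).restrict (hthi x₀).restrict] at h1
      rw [integral_zero]
      linarith
    refine hφ0 ((ae_restrict_iff' hA).2 ?_)
    filter_upwards [hae] with ω h1 hω
    have hpos : 0 < h ω x₀ := by
      rw [hx₀]
      exact hω
    simpa [t, hω, hpos.ne'] using h1
  filter_upwards [ae_all_iff.2 fun n => hq0 (TopologicalSpace.denseSeq X n)] with ω hω h h₁ h₂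
  have hnonpos : ∀ x, h x ≤ 0 := by
    have hcl : IsClosed {x | h x ≤ 0} := isClosed_le h.continuous continuous_const
    intro x
    refine hcl.closure_subset_iff.2 ?_ (TopologicalSpace.denseRange_denseSeq X x)
    rintro _ ⟨n, rfl⟩
    exact (le_pinching h₁ h₂ _).trans (hω n)
  ext x
  have h3 := hnonpos (-x)
  rw [map_neg] at h3
  rw [zero_apply]
  linarith [hnonpos x]

end Extremal

section GelfandIntegral

variable {X : Type u} [NormedAddCommGroup X] [NormedSpace ℝ X]
variable {Ω : Type v} [MeasurableSpace Ω]
variable {μ : Measure Ω} {Γ : Ω → Set (X →L[ℝ] ℝ)} {ψ : Ω → ℝ}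

theorem exists_isDominated_of_mem_gelfandIntegral (hne : ∀ ω, (Γ ω).Nonempty)
    (hψ : Integrable ψ μ) (hb : ∀ ω, ∀ φ ∈ Γ ω, ‖φ‖ ≤ ψ ω) (hm : WScalarlyMeasurable Γ)
    {g : X →L[ℝ] ℝ} (hg : g ∈ gelfandIntegral μ fun ω => wstarClosedConvexHull (Γ ω)) :
    ∃ F, IsDominated μ (fun ω x => supp x (Γ ω)) F ∧ F ⟨univ, MeasurableSet.univ⟩ = g := by
  obtain ⟨f, ⟨⟨hfi, -⟩, hf⟩, hfg⟩ := hg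
  refine ⟨_, IsDominated.setIntegral_of_le hψ (fun ω => boundedSublinear_supp (hne ω) (hb ω)) hm
    hfi fun x => ?_, ?_⟩
  · filter_upwards [hf] with ω h using (mem_wstarClosedConvexHull_iff (hne ω) (hb ω)).1 h x
  · ext x
    rw [hfg, Measure.restrict_univ]

theorem gelfandIntegral_subset_wstarClosedConvexHull (hne : ∀ ω, (Γ ω).Nonempty)
    (hb : ∀ ω, ∀ φ ∈ Γ ω, ‖φ‖ ≤ ψ ω) :
    gelfandIntegral μ Γ ⊆ gelfandIntegral μ fun ω => wstarClosedConvexHull (Γ ω) := by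
  rintro g ⟨f, ⟨hfi, hf⟩, hfg⟩
  exact ⟨f, ⟨hfi, hf.mono fun ω h =>
    (mem_wstarClosedConvexHull_iff (hne ω) (hb ω)).2 (le_supp (hb ω) h)⟩, hfg⟩

theorem mem_gelfandIntegral_of_isDominated [TopologicalSpace.SeparableSpace X]
    [IsFiniteMeasure μ] (hsat : Saturated μ) (hne : ∀ ω, (Γ ω).Nonempty)
    (hcl : ∀ ω, WStarClosed (Γ ω)) (hψ : Integrable ψ μ) (hb : ∀ ω, ∀ φ ∈ Γ ω, ‖φ‖ ≤ ψ ω)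
    (hm : WScalarlyMeasurable Γ) {F : {A : Set Ω // MeasurableSet A} → X → ℝ}
    (hF : IsDominated μ (fun ω x => supp x (Γ ω)) F) {g : X →L[ℝ] ℝ}
    (hFg : F ⟨univ, MeasurableSet.univ⟩ = g) : g ∈ gelfandIntegral μ Γ := by
  have hs : ∀ ω, BoundedSublinear (fun x => supp x (Γ ω)) (ψ ω) := fun ω =>
    boundedSublinear_supp (hne ω) (hb ω)
  have hK : IsCompact {F | IsDominated μ (fun ω x => supp x (Γ ω)) F ∧
      F ⟨univ, MeasurableSet.univ⟩ = (g : X → ℝ)} :=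
    (isCompact_setOf_isDominated hψ hs hm).inter_right
      (isClosed_eq (continuous_apply _) continuous_const)
  obtain ⟨F', hF'⟩ := hK.extremePoints_nonempty ⟨F, hF, hFg⟩
  obtain ⟨f, hfm, hfs, hfF⟩ := hF'.1.1.exists_density hψ hs hm
  obtain rfl : F' = fun A x => ∫ ω in A.1, f ω x ∂μ := funext fun A => funext (hfF A)
  have hg : ∀ x, g x = ∫ ω, f ω x ∂μ := fun x => by
    simp only [← hF'.1.2, Measure.restrict_univ]
  refine ⟨f, ⟨⟨integrable_of_boundedSublinear hψ (fun ω => (hs ω).of_le (hfs ω)) hfm, g, hg⟩, ?_⟩,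
    hg⟩
  filter_upwards [ae_eq_zero_of_mem_extremePoints hsat hψ hs hm hfm hfs hF'] with ω hω
  exact mem_of_forall_add_sub_le_supp (hne ω) (hcl ω) (hb ω) (hfs ω) hω

theorem mem_gelfandIntegral_iff_exists_isDominated [TopologicalSpace.SeparableSpace X]
    [IsFiniteMeasure μ] (hsat : Saturated μ) (hne : ∀ ω, (Γ ω).Nonempty)
    (hcl : ∀ ω, WStarClosed (Γ ω)) (hψ : Integrable ψ μ) (hb : ∀ ω, ∀ φ ∈ Γ ω, ‖φ‖ ≤ ψ ω)
    (hm : WScalarlyMeasurable Γ) {g : X →L[ℝ] ℝ} :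
    g ∈ gelfandIntegral μ Γ ↔
      ∃ F, IsDominated μ (fun ω x => supp x (Γ ω)) F ∧ F ⟨univ, MeasurableSet.univ⟩ = g :=
  ⟨fun h => exists_isDominated_of_mem_gelfandIntegral hne hψ hb hm
    (gelfandIntegral_subset_wstarClosedConvexHull hne hb h),
    fun ⟨_, hF, hFg⟩ => mem_gelfandIntegral_of_isDominated hsat hne hcl hψ hb hm hF hFg⟩

end GelfandIntegral

/-- over a complete saturated finite measure space, for `X` a separable
Asplund space, the Gelfand integral of an integrably bounded, w*-scalarly measurable
multifunction with nonempty w*-closed values is weak*-compact and convex without any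
closure operation, and equals the Gelfand integral of the weak*-closed convex hull. -/
theorem gelfand_integral_convex_saturated
    {X : Type u} [NormedAddCommGroup X] [NormedSpace ℝ X] [CompleteSpace X]
    [TopologicalSpace.SeparableSpace X]
    (hX : Asplund X)
    {Ω : Type v} [MeasurableSpace Ω] (μ : Measure Ω)
    (hcomp : μ.IsComplete) [IsFiniteMeasure μ]
    (hsat : Saturated μ)
    (Γ : Ω → Set (X →L[ℝ] ℝ))
    (hne : ∀ ω, (Γ ω).Nonempty)
    (hcl : ∀ ω, WStarClosed (Γ ω))
    (hb : IntegrablyBounded μ Γ)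
    (hm : WScalarlyMeasurable Γ) :
    WStarCompact (gelfandIntegral μ Γ) ∧
    Convex ℝ (gelfandIntegral μ Γ) ∧
    gelfandIntegral μ Γ =
      gelfandIntegral μ (fun ω => wstarClosedConvexHull (Γ ω)) := by
  obtain ⟨ψ, hψ, hψb⟩ := hb
  have hmem := fun g => mem_gelfandIntegral_iff_exists_isDominated (g := g) hsat hne hcl hψ hψb hm
  have hs : ∀ ω, BoundedSublinear (fun x => supp x (Γ ω)) (ψ ω) := fun ω =>
    boundedSublinear_supp (hne ω) (hψb ω)
  refine ⟨?_, ?_, (gelfandIntegral_subset_wstarClosedConvexHull hne hψb).antisymm fun g hg =>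
    (hmem g).2 (exists_isDominated_of_mem_gelfandIntegral hne hψ hψb hm hg)⟩
  · have hind : IsInducing fun (φ : WeakDual ℝ X) (x : X) => φ x := ⟨rfl⟩
    rw [WStarCompact, hind.isCompact_iff]
    convert (isCompact_setOf_isDominated hψ hs hm).image
      (continuous_apply ⟨univ, MeasurableSet.univ⟩) using 1
    ext v
    constructor
    · rintro ⟨_, ⟨g, hg, rfl⟩, rfl⟩
      obtain ⟨F, hF, hFg⟩ := (hmem g).1 hg
      exact ⟨F, hF, hFg⟩
    · rintro ⟨F, hF, rfl⟩
      obtain ⟨φ, hφ⟩ := exists_clm_of_odd_on_dense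
        (fun x y => (hF.map_add ⟨univ, MeasurableSet.univ⟩ x y).le)
        (fun x => ((le_abs_self _).trans (hF.abs_le hψ hs hm _ x)).trans_eq
          (integral_mul_const _ _)) dense_univ fun d _ => by
            rw [← hF.map_add, add_neg_cancel]
            simpa using (hF.map_add ⟨univ, MeasurableSet.univ⟩ 0 0).ge
      exact ⟨φ, ⟨φ, (hmem φ).2 ⟨F, hF, (funext hφ).symm⟩, rfl⟩, funext hφ⟩
  · intro g₁ h₁ g₂ h₂ a b ha hb hab
    obtain ⟨F₁, hF₁, hg₁⟩ := (hmem g₁).1 h₁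
    obtain ⟨F₂, hF₂, hg₂⟩ := (hmem g₂).1 h₂
    refine (hmem _).2 ⟨a • F₁ + b • F₂, convex_setOf_isDominated hF₁ hF₂ ha hb hab, ?_⟩
    ext x
    simp [hg₁, hg₂]

end Paper
end
end

section
/- In the setting of the generalized-gradient Leibniz rule (complete finite measure space (Ω,Σ,μ), Banach space X, integrand φ: X × Ω → ℝ Lipschitz in x on a neighborhood U of x̄ with uniformly integrable modulus, measurable and integrable in ω, with ω ↦ ∂°φ(x̄,ω) w*-scalarly measurable), assume in addition that φ(·,ω) is regular at x̄ for every ω ∈ Ω. Then the integral functional I_φ(x) := ∫ φ(x,ω) dμ is regular at x̄ and ∂°I_φ(x̄) = w*-∫ ∂°φ(x̄,ω) dμ. -/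
open MeasureTheory Filter Topology Metric Set Pointwise
open scoped NNReal ENNReal

noncomputable section

universe u v

namespace Paper

section Clarke

variable {X : Type u} [NormedAddCommGroup X] [NormedSpace ℝ X]

/-- The difference quotient whose upper limit is the generalized directional derivative. -/
def diffQuot (ψ : X → ℝ) (h : X) (p : X × ℝ) : ℝ := (ψ (p.1 + p.2 • h) - ψ p.1) / p.2

lemma tendsto_add_smul (x h : X) :
    Tendsto (fun p : X × ℝ => p.1 + p.2 • h) (𝓝 x ×ˢ 𝓝[>] (0 : ℝ)) (𝓝 x) := by
  have hc : Continuous fun p : X × ℝ => p.1 + p.2 • h := by fun_prop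
  have h1 := hc.tendsto (x, (0 : ℝ))
  simp only [zero_smul, add_zero, nhds_prod_eq] at h1
  exact h1.mono_left (Filter.prod_mono le_rfl nhdsWithin_le_nhds)

lemma eventually_mem_and_pos {x : X} {U : Set X} (hU : U ∈ 𝓝 x) (h : X) :
    ∀ᶠ p : X × ℝ in 𝓝 x ×ˢ 𝓝[>] (0 : ℝ), p.1 ∈ U ∧ p.1 + p.2 • h ∈ U ∧ 0 < p.2 := by
  filter_upwards [tendsto_fst.eventually hU, (tendsto_add_smul x h).eventually hU,
    tendsto_snd.eventually self_mem_nhdsWithin] with p h1 h2 h3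
  exact ⟨h1, h2, h3⟩

lemma abs_diffQuot_le {ψ : X → ℝ} {U : Set X} {K : ℝ}
    (hψ : ∀ x ∈ U, ∀ y ∈ U, |ψ x - ψ y| ≤ K * ‖x - y‖) {h : X} {p : X × ℝ}
    (hp : p.1 ∈ U ∧ p.1 + p.2 • h ∈ U ∧ 0 < p.2) : |diffQuot ψ h p| ≤ K * ‖h‖ := by
  obtain ⟨h1, h2, h3⟩ := hp
  rw [diffQuot, abs_div, abs_of_pos h3, div_le_iff₀ h3]
  refine (hψ _ h2 _ h1).trans_eq ?_
  rw [add_sub_cancel_left, norm_smul, Real.norm_of_nonneg h3.le]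
  ring

/-- `ψ` satisfies a Lipschitz estimate with constant `K` near `x`. -/
def LipNear (ψ : X → ℝ) (x : X) (K : ℝ) : Prop :=
  ∃ U ∈ 𝓝 x, ∀ y ∈ U, ∀ z ∈ U, |ψ y - ψ z| ≤ K * ‖y - z‖

variable {ψ : X → ℝ} {x : X} {K : ℝ}

lemma LipNear.eventually_abs_diffQuot_le (hψ : LipNear ψ x K) (h : X) :
    ∀ᶠ p in 𝓝 x ×ˢ 𝓝[>] (0 : ℝ), |diffQuot ψ h p| ≤ K * ‖h‖ := by
  obtain ⟨U, hU, hL⟩ := hψ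
  filter_upwards [eventually_mem_and_pos hU h] with p hp using abs_diffQuot_le hL hp

lemma LipNear.eventually_diffQuot_lt (hψ : LipNear ψ x K) {h : X} {a : ℝ}
    (ha : clarkeDD ψ x h < a) : ∀ᶠ p in 𝓝 x ×ˢ 𝓝[>] (0 : ℝ), diffQuot ψ h p < a :=
  eventually_lt_of_limsup_lt ha
    ⟨K * ‖h‖, eventually_map.2 <| (hψ.eventually_abs_diffQuot_le h).mono fun _ hp =>
      (abs_le.1 hp).2⟩

lemma LipNear.isCoboundedUnder (hψ : LipNear ψ x K) (h : X) :
    IsCoboundedUnder (· ≤ ·) (𝓝 x ×ˢ 𝓝[>] (0 : ℝ)) (diffQuot ψ h) :=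
  IsBoundedUnder.isCoboundedUnder_le
    ⟨-(K * ‖h‖), eventually_map.2 <| (hψ.eventually_abs_diffQuot_le h).mono fun _ hp =>
      (abs_le.1 hp).1⟩

lemma LipNear.clarkeDD_le (hψ : LipNear ψ x K) {h : X} {a : ℝ}
    (ha : ∀ᶠ p in 𝓝 x ×ˢ 𝓝[>] (0 : ℝ), diffQuot ψ h p ≤ a) : clarkeDD ψ x h ≤ a :=
  limsup_le_of_le (hψ.isCoboundedUnder h) ha

lemma LipNear.clarkeDD_le_mul_norm (hψ : LipNear ψ x K) (h : X) :
    clarkeDD ψ x h ≤ K * ‖h‖ :=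
  hψ.clarkeDD_le <| (hψ.eventually_abs_diffQuot_le h).mono fun _ hp => (abs_le.1 hp).2

lemma LipNear.neg_mul_norm_le_clarkeDD (hψ : LipNear ψ x K) (h : X) :
    -(K * ‖h‖) ≤ clarkeDD ψ x h := by
  by_contra! hlt
  obtain ⟨p, hp, hp'⟩ :=
    ((hψ.eventually_diffQuot_lt hlt).and (hψ.eventually_abs_diffQuot_le h)).exists
  exact (abs_le.1 hp').1.not_gt hp

lemma LipNear.clarkeDD_zero (hψ : LipNear ψ x K) : clarkeDD ψ x 0 = 0 := by
  have h1 := hψ.clarkeDD_le_mul_norm 0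
  have h2 := hψ.neg_mul_norm_le_clarkeDD 0
  simp only [norm_zero, mul_zero, neg_zero] at h1 h2
  exact le_antisymm h1 h2

lemma LipNear.clarkeDD_add_le (hψ : LipNear ψ x K) (h k : X) :
    clarkeDD ψ x (h + k) ≤ clarkeDD ψ x h + clarkeDD ψ x k := by
  refine le_of_forall_pos_le_add fun ε hε => hψ.clarkeDD_le ?_
  have hshift : Tendsto (fun p : X × ℝ => (p.1 + p.2 • k, p.2)) (𝓝 x ×ˢ 𝓝[>] (0 : ℝ))
      (𝓝 x ×ˢ 𝓝[>] (0 : ℝ)) := (tendsto_add_smul x k).prodMk tendsto_snd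
  have h1 := hshift.eventually
    (hψ.eventually_diffQuot_lt (lt_add_of_pos_right (clarkeDD ψ x h) (half_pos hε)))
  filter_upwards [h1, hψ.eventually_diffQuot_lt
    (lt_add_of_pos_right (clarkeDD ψ x k) (half_pos hε))] with p hp hq
  have : diffQuot ψ (h + k) p = diffQuot ψ h (p.1 + p.2 • k, p.2) + diffQuot ψ k p := by
    simp only [diffQuot]
    rw [← add_div, smul_add, add_comm (p.2 • h), ← add_assoc]
    ring
  linarith

lemma LipNear.clarkeDD_smul_le (hψ : LipNear ψ x K) {c : ℝ} (hc : 0 < c) (h : X) :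
    clarkeDD ψ x (c • h) ≤ c * clarkeDD ψ x h := by
  refine le_of_forall_pos_le_add fun ε hε => hψ.clarkeDD_le ?_
  have hs : Tendsto (fun θ : ℝ => θ * c) (𝓝[>] (0 : ℝ)) (𝓝[>] (0 : ℝ)) := by
    refine tendsto_nhdsWithin_iff.2 ⟨?_, ?_⟩
    · have : Tendsto (fun θ : ℝ => θ * c) (𝓝 0) (𝓝 (0 * c)) :=
        (continuous_mul_const c).tendsto 0
      rw [zero_mul] at this
      exact this.mono_left nhdsWithin_le_nhds
    · filter_upwards [self_mem_nhdsWithin] with θ hθ using mul_pos hθ hc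
  have hshift : Tendsto (fun p : X × ℝ => (p.1, p.2 * c)) (𝓝 x ×ˢ 𝓝[>] (0 : ℝ))
      (𝓝 x ×ˢ 𝓝[>] (0 : ℝ)) := tendsto_fst.prodMk (hs.comp tendsto_snd)
  filter_upwards [hshift.eventually
    (hψ.eventually_diffQuot_lt (lt_add_of_pos_right (clarkeDD ψ x h) (div_pos hε hc)))]
    with p hp
  have : diffQuot ψ (c • h) p = c * diffQuot ψ h (p.1, p.2 * c) := by
    simp only [diffQuot, smul_smul]
    rw [mul_comm p.2 c, ← mul_div_assoc, mul_div_mul_left _ _ hc.ne']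
  rw [this]
  calc c * diffQuot ψ h (p.1, p.2 * c) ≤ c * (clarkeDD ψ x h + ε / c) := by gcongr
    _ = c * clarkeDD ψ x h + ε := by field_simp

lemma LipNear.clarkeDD_smul (hψ : LipNear ψ x K) {c : ℝ} (hc : 0 < c) (h : X) :
    clarkeDD ψ x (c • h) = c * clarkeDD ψ x h := by
  refine le_antisymm (hψ.clarkeDD_smul_le hc h) ?_
  have := hψ.clarkeDD_smul_le (inv_pos.2 hc) (c • h)
  rwa [inv_smul_smul₀ hc.ne', le_inv_mul_iff₀ hc] at this

lemma LipNear.mul_clarkeDD_le (hψ : LipNear ψ x K) (c : ℝ) (h : X) :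
    c * clarkeDD ψ x h ≤ clarkeDD ψ x (c • h) := by
  rcases lt_trichotomy c 0 with hc | rfl | hc
  · have h1 := hψ.clarkeDD_add_le (c • h) ((-c) • h)
    rw [← add_smul, add_neg_cancel, zero_smul, hψ.clarkeDD_zero,
      hψ.clarkeDD_smul (neg_pos.2 hc)] at h1
    linarith
  · simp [hψ.clarkeDD_zero]
  · exact (hψ.clarkeDD_smul hc h).ge

lemma LipNear.abs_apply_le (hψ : LipNear ψ x K) {g : X →ₗ[ℝ] ℝ}
    (hg : ∀ h, g h ≤ clarkeDD ψ x h) (h : X) : ‖g h‖ ≤ K * ‖h‖ := by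
  have h1 := (hg h).trans (hψ.clarkeDD_le_mul_norm h)
  have h2 := (hg (-h)).trans (hψ.clarkeDD_le_mul_norm (-h))
  rw [map_neg, norm_neg] at h2
  exact abs_le.2 ⟨by linarith, h1⟩

lemma LipNear.exists_mem_clarkeSubdiff (hψ : LipNear ψ x K) (z : X) :
    ∃ g ∈ clarkeSubdiff ψ x, g z = clarkeDD ψ x z := by
  obtain ⟨f, hfz, hf⟩ : ∃ f : X →ₗ.[ℝ] ℝ,
      (∀ g : X →ₗ[ℝ] ℝ, (∀ y : f.domain, g y = f y) → g z = clarkeDD ψ x z) ∧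
      ∀ y : f.domain, f y ≤ clarkeDD ψ x y := by
    rcases eq_or_ne z 0 with rfl | hz
    · refine ⟨⊥, fun g _ => by rw [map_zero, hψ.clarkeDD_zero], ?_⟩
      rintro ⟨y, hy⟩
      obtain rfl : y = 0 := (Submodule.mem_bot ℝ).1 hy
      exact (map_zero _).trans_le hψ.clarkeDD_zero.ge
    · refine ⟨LinearPMap.mkSpanSingleton z (clarkeDD ψ x z) hz, fun g hg => ?_, ?_⟩
      · exact (hg ⟨z, Submodule.mem_span_singleton_self z⟩).trans
          (LinearPMap.mkSpanSingleton_apply ℝ ℝ hz _)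
      · rintro ⟨y, hy⟩
        obtain ⟨c, rfl⟩ := Submodule.mem_span_singleton.1 hy
        exact (LinearPMap.mkSpanSingleton'_apply z _ _ c hy).trans_le
          (hψ.mul_clarkeDD_le c z)
  obtain ⟨g, hgf, hg⟩ := exists_extension_of_le_sublinear f (clarkeDD ψ x)
    (fun c hc y => hψ.clarkeDD_smul hc y) hψ.clarkeDD_add_le hf
  exact ⟨g.mkContinuous K (hψ.abs_apply_le hg), hg, hfz g hgf⟩

lemma LipNear.supp_clarkeSubdiff (hψ : LipNear ψ x K) (z : X) :
    supp z (clarkeSubdiff ψ x) = clarkeDD ψ x z := by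
  obtain ⟨g, hg, hgz⟩ := hψ.exists_mem_clarkeSubdiff z
  refine IsGreatest.csSup_eq ⟨⟨g, hg, hgz⟩, ?_⟩
  rintro _ ⟨f, hf, rfl⟩
  exact hf z

lemma convex_clarkeSubdiff (ψ : X → ℝ) (x : X) : Convex ℝ (clarkeSubdiff ψ x) := by
  intro f hf g hg a b ha hb hab h
  calc a * f h + b * g h ≤ a * clarkeDD ψ x h + b * clarkeDD ψ x h := by
        gcongr
        · exact hf h
        · exact hg h
    _ = clarkeDD ψ x h := by rw [← add_mul, hab, one_mul]

lemma LipNear.wStarCompact_clarkeSubdiff (hψ : LipNear ψ x K) (hK : 0 ≤ K) :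
    WStarCompact (clarkeSubdiff ψ x) := by
  have himg : wstar '' clarkeSubdiff ψ x =
      ⋂ h : X, {f : WeakDual ℝ X | f h ≤ clarkeDD ψ x h} := by
    ext f
    simp only [mem_image, mem_iInter, mem_ofPred_eq]
    exact ⟨by rintro ⟨g, hg, rfl⟩; exact hg, fun hf => ⟨f, hf, rfl⟩⟩
  have hclosed : IsClosed (wstar '' clarkeSubdiff ψ x) := by
    rw [himg]
    exact isClosed_iInter fun h => isClosed_le (WeakDual.eval_continuous h) continuous_const
  refine (WeakDual.isCompact_closedBall (0 : StrongDual ℝ X) K).of_isClosed_subset hclosed ?_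
  rintro _ ⟨g, hg, rfl⟩
  refine mem_closedBall_zero_iff.2 ?_
  exact ContinuousLinearMap.opNorm_le_bound g hK (hψ.abs_apply_le (g := (g : X →ₗ[ℝ] ℝ)) hg)

end Clarke

section IntegralFunctional

variable {X : Type u} [NormedAddCommGroup X] [NormedSpace ℝ X]
variable {Ω : Type v} [MeasurableSpace Ω] {μ : Measure Ω}
variable {φ : X → Ω → ℝ} {x : X} {U : Set X} {l : Ω → ℝ}

lemma lipNear_integral (hU : U ∈ 𝓝 x) (hl : Integrable l μ)
    (hLip : ∀ ω, ∀ y ∈ U, ∀ z ∈ U, |φ y ω - φ z ω| ≤ l ω * ‖y - z‖)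
    (hint : ∀ y ∈ U, Integrable (φ y) μ) :
    LipNear (fun y => ∫ ω, φ y ω ∂μ) x (∫ ω, l ω ∂μ) := by
  refine ⟨U, hU, fun y hy z hz => ?_⟩
  rw [← integral_sub (hint y hy) (hint z hz), ← integral_mul_const]
  exact norm_integral_le_of_norm_le (f := fun ω => φ y ω - φ z ω) (hl.mul_const _)
    (ae_of_all _ fun ω => hLip ω y hy z hz)

lemma integrable_diffQuot (hint : ∀ y ∈ U, Integrable (φ y) μ) {h : X} {p : X × ℝ}
    (hp : p.1 ∈ U ∧ p.1 + p.2 • h ∈ U ∧ 0 < p.2) :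
    Integrable (fun ω => diffQuot (φ · ω) h p) μ :=
  ((hint _ hp.2.1).sub (hint _ hp.1)).div_const _

lemma diffQuot_integral (hint : ∀ y ∈ U, Integrable (φ y) μ) {h : X} {p : X × ℝ}
    (hp : p.1 ∈ U ∧ p.1 + p.2 • h ∈ U ∧ 0 < p.2) :
    diffQuot (fun y => ∫ ω, φ y ω ∂μ) h p = ∫ ω, diffQuot (φ · ω) h p ∂μ := by
  simp only [diffQuot]
  rw [integral_div, integral_sub (hint _ hp.2.1) (hint _ hp.1)]

/-- An upper Fatou estimate for generalized directional derivatives. -/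
lemma clarkeDD_integral_le (hU : U ∈ 𝓝 x) (hl : Integrable l μ)
    (hLip : ∀ ω, ∀ y ∈ U, ∀ z ∈ U, |φ y ω - φ z ω| ≤ l ω * ‖y - z‖)
    (hint : ∀ y ∈ U, Integrable (φ y) μ) {h : X}
    (hmeas : AEStronglyMeasurable (fun ω => clarkeDD (φ · ω) x h) μ) :
    clarkeDD (fun y => ∫ ω, φ y ω ∂μ) x h ≤ ∫ ω, clarkeDD (φ · ω) x h ∂μ := by
  have hnear : ∀ ω, LipNear (φ · ω) x (l ω) := fun ω => ⟨U, hU, hLip ω⟩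
  have hDabs : ∀ ω, |clarkeDD (φ · ω) x h| ≤ l ω * ‖h‖ := fun ω =>
    abs_le.2 ⟨(hnear ω).neg_mul_norm_le_clarkeDD h, (hnear ω).clarkeDD_le_mul_norm h⟩
  have hD : Integrable (fun ω => clarkeDD (φ · ω) x h) μ :=
    (hl.mul_const ‖h‖).mono' hmeas (ae_of_all _ hDabs)
  have hlim : Tendsto
      (fun p => ∫ ω, max (diffQuot (φ · ω) h p) (clarkeDD (φ · ω) x h) ∂μ)
      (𝓝 x ×ˢ 𝓝[>] (0 : ℝ)) (𝓝 (∫ ω, clarkeDD (φ · ω) x h ∂μ)) := by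
    refine tendsto_integral_filter_of_dominated_convergence (fun ω => l ω * ‖h‖) ?_ ?_
      (hl.mul_const _) (ae_of_all _ fun ω => ?_)
    · filter_upwards [eventually_mem_and_pos hU h] with p hp
      exact ((integrable_diffQuot hint hp).sup hD).aestronglyMeasurable
    · filter_upwards [eventually_mem_and_pos hU h] with p hp
      exact ae_of_all _ fun ω =>
        abs_max_le_max_abs_abs.trans (max_le (abs_diffQuot_le (hLip ω) hp) (hDabs ω))
    · refine tendsto_order.2 ⟨fun a ha => ?_, fun a ha => ?_⟩
      · exact Eventually.of_forall fun p => ha.trans_le (le_max_right _ _)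
      · exact ((hnear ω).eventually_diffQuot_lt ha).mono fun p hp => max_lt hp ha
  refine le_of_forall_pos_le_add fun ε hε => (lipNear_integral hU hl hLip hint).clarkeDD_le ?_
  filter_upwards [eventually_mem_and_pos hU h,
    hlim.eventually_lt_const (lt_add_of_pos_right _ hε)] with p hp hlt
  rw [diffQuot_integral hint hp]
  exact (integral_mono (integrable_diffQuot hint hp) ((integrable_diffQuot hint hp).sup hD)
    fun ω => le_max_left _ _).trans hlt.le

lemma tendsto_diffQuot_integral (hU : U ∈ 𝓝 x) (hl : Integrable l μ)
    (hLip : ∀ ω, ∀ y ∈ U, ∀ z ∈ U, |φ y ω - φ z ω| ≤ l ω * ‖y - z‖)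
    (hint : ∀ y ∈ U, Integrable (φ y) μ)
    (hreg : ∀ ω, ClarkeRegularAt (φ · ω) x) (h : X) :
    Tendsto (fun θ : ℝ => diffQuot (fun y => ∫ ω, φ y ω ∂μ) h (x, θ)) (𝓝[>] (0 : ℝ))
      (𝓝 (∫ ω, clarkeDD (φ · ω) x h ∂μ)) := by
  have hev : ∀ᶠ θ : ℝ in 𝓝[>] (0 : ℝ), x ∈ U ∧ x + θ • h ∈ U ∧ 0 < θ :=
    ((tendsto_const_pure.mono_right (pure_le_nhds x)).prodMk tendsto_id).eventually
      (eventually_mem_and_pos hU h)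
  have hlim : Tendsto (fun θ : ℝ => ∫ ω, diffQuot (φ · ω) h (x, θ) ∂μ) (𝓝[>] (0 : ℝ))
      (𝓝 (∫ ω, clarkeDD (φ · ω) x h ∂μ)) := by
    refine tendsto_integral_filter_of_dominated_convergence (fun ω => l ω * ‖h‖) ?_ ?_
      (hl.mul_const _) (ae_of_all _ fun ω => hreg ω h)
    · filter_upwards [hev] with θ hθ
      exact (integrable_diffQuot (p := (x, θ)) hint hθ).aestronglyMeasurable
    · filter_upwards [hev] with θ hθ
      exact ae_of_all _ fun ω => abs_diffQuot_le (p := (x, θ)) (hLip ω) hθ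
  refine hlim.congr' ?_
  filter_upwards [hev] with θ hθ
  exact (diffQuot_integral (p := (x, θ)) hint hθ).symm

lemma LipNear.le_clarkeDD_of_tendsto {ψ : X → ℝ} {K : ℝ} (hψ : LipNear ψ x K) {h : X} {a : ℝ}
    (ha : Tendsto (fun θ : ℝ => diffQuot ψ h (x, θ)) (𝓝[>] (0 : ℝ)) (𝓝 a)) :
    a ≤ clarkeDD ψ x h := by
  refine le_of_forall_gt_imp_ge_of_dense fun b hb => le_of_tendsto ha ?_
  exact (((tendsto_const_pure.mono_right (pure_le_nhds x)).prodMk tendsto_id).eventually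
    (hψ.eventually_diffQuot_lt hb)).mono fun _ hθ => hθ.le

end IntegralFunctional

/-- under the additional regularity of `φ(·,ω)` at `x̄` for every `ω`,
the integral functional is regular at `x̄` and the generalized-gradient Leibniz rule
holds as an equality with the w*-integral of the generalized gradient mapping. -/
theorem clarke_leibniz_rule_regular
    {X : Type u} [NormedAddCommGroup X] [NormedSpace ℝ X] [CompleteSpace X]
    {Ω : Type v} [MeasurableSpace Ω] (μ : Measure Ω)
    (hcomp : μ.IsComplete) [IsFiniteMeasure μ]
    (φ : X → Ω → ℝ) (xbar : X) (U : Set X) (hU : U ∈ 𝓝 xbar)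
    (l : Ω → ℝ) (hl : Integrable l μ)
    (hLip : ∀ ω, ∀ x ∈ U, ∀ x' ∈ U, |φ x ω - φ x' ω| ≤ l ω * ‖x - x'‖)
    (hmeas : ∀ x ∈ U, Measurable fun ω => φ x ω)
    (hint : ∀ x ∈ U, Integrable (fun ω => φ x ω) μ)
    (hscal : ∀ z : X, Measurable fun ω => supp z (clarkeSubdiff (fun x => φ x ω) xbar))
    (hreg : ∀ ω, ClarkeRegularAt (fun x => φ x ω) xbar) :
    ClarkeRegularAt (fun x => ∫ ω, φ x ω ∂μ) xbar ∧
    ∃ C : Set (X →L[ℝ] ℝ), Convex ℝ C ∧ WStarCompact C ∧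
      (∀ z : X, supp z C = ∫ ω, supp z (clarkeSubdiff (fun x => φ x ω) xbar) ∂μ) ∧
      clarkeSubdiff (fun x => ∫ ω, φ x ω ∂μ) xbar = C := by
  have hDD : ∀ ω z, supp z (clarkeSubdiff (fun x => φ x ω) xbar) =
      clarkeDD (fun x => φ x ω) xbar z := fun ω =>
    LipNear.supp_clarkeSubdiff ⟨U, hU, hLip ω⟩
  have hI := lipNear_integral hU hl hLip hint
  have hlim := tendsto_diffQuot_integral hU hl hLip hint hreg
  have heq : ∀ h, clarkeDD (fun x => ∫ ω, φ x ω ∂μ) xbar h =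
      ∫ ω, clarkeDD (fun x => φ x ω) xbar h ∂μ := fun h =>
    le_antisymm
      (clarkeDD_integral_le hU hl hLip hint <| by
        simpa only [hDD] using (hscal h).aestronglyMeasurable)
      (hI.le_clarkeDD_of_tendsto (hlim h))
  refine ⟨fun h => ?_, _, convex_clarkeSubdiff _ _, ?_, fun z => ?_, rfl⟩
  · rw [heq h]
    exact hlim h
  · obtain ⟨V, hV, hVL⟩ := hI
    refine LipNear.wStarCompact_clarkeSubdiff
      (K := |∫ ω, l ω ∂μ|) ⟨V, hV, fun y hy z hz => (hVL y hy z hz).trans ?_⟩ (abs_nonneg _)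
    gcongr
    exact le_abs_self _
  · rw [hI.supp_clarkeSubdiff, heq]
    simp only [hDD]

end Paper
end
end

section
/- Let (Ω,Σ,μ) be a complete finite measure space and X a Banach space. Let φ: X × Ω → ℝ be Lipschitz in x on a neighborhood U of x̄ for every ω with a μ-integrable Lipschitz modulus uniform on U, with φ(x,·) measurable and μ-integrable for every x near x̄. Suppose that φ(·,ω) is strictly differentiable at x̄ for every ω ∈ Ω with ω ↦ ‖∇_x φ(x̄,ω)‖ belonging to L¹(μ). Then the integral functional I_φ(x) := ∫ φ(x,ω) dμ is locally Lipschitzian around x̄, strictly differentiable at x̄, and ∇I_φ(x̄) equals the Gelfand integral ∫ ∇_x φ(x̄,ω) dμ. -/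
open MeasureTheory Filter Topology Metric Set Pointwise
open scoped NNReal ENNReal

noncomputable section

universe u v

namespace Paper

/-- A pointwise derivative of a family of measurable functions is weak* scalarly measurable. -/
theorem aestronglyMeasurable_apply_of_hasFDerivAt
    {X : Type u} [NormedAddCommGroup X] [NormedSpace ℝ X]
    {Ω : Type v} [MeasurableSpace Ω] {μ : Measure Ω}
    {φ : X → Ω → ℝ} {xbar : X} {U : Set X} (hU : U ∈ 𝓝 xbar)
    (hmeas : ∀ x ∈ U, AEStronglyMeasurable (fun ω => φ x ω) μ)
    {Dφ : Ω → X →L[ℝ] ℝ}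
    (hdiff : ∀ ω, HasFDerivAt (fun x => φ x ω) (Dφ ω) xbar) (z : X) :
    AEStronglyMeasurable (fun ω => Dφ ω z) μ := by
  have hc : Tendsto (fun n : ℕ => (n : ℝ)) atTop atTop := tendsto_natCast_atTop_atTop
  have hx : Tendsto (fun n : ℕ => xbar + (n : ℝ)⁻¹ • z) atTop (𝓝 xbar) := by
    simpa using ((tendsto_inv_atTop_zero.comp hc).smul_const z).const_add xbar
  obtain ⟨N, hN⟩ := eventually_atTop.1 (hx.eventually_mem hU)
  refine aestronglyMeasurable_of_tendsto_ae atTop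
    (f := fun (n : ℕ) ω => ((n + N : ℕ) : ℝ) •
      (φ (xbar + ((n + N : ℕ) : ℝ)⁻¹ • z) ω - φ xbar ω)) (fun n => ?_)
    (Eventually.of_forall fun ω => ?_)
  · exact ((hmeas _ (hN _ (Nat.le_add_left N n))).sub
      (hmeas _ (mem_of_mem_nhds hU))).const_smul ((n + N : ℕ) : ℝ)
  · have hnorm : Tendsto (fun n : ℕ => ‖(n : ℝ)‖) atTop atTop := by simpa using hc
    exact ((hdiff ω).lim z hnorm).comp (tendsto_add_atTop_nat N)

/-- A norm-integrable, weak* scalarly measurable function into the dual has a Gelfand integral. -/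
theorem gelfandIntegrable_of_integrable_norm
    {X : Type u} [NormedAddCommGroup X] [NormedSpace ℝ X]
    {Ω : Type v} [MeasurableSpace Ω] {μ : Measure Ω} {f : Ω → X →L[ℝ] ℝ}
    (hf : ∀ z, AEStronglyMeasurable (fun ω => f ω z) μ)
    (hnorm : Integrable (fun ω => ‖f ω‖) μ) : GelfandIntegrable μ f := by
  have hint : ∀ z, Integrable (fun ω => f ω z) μ := fun z =>
    (hnorm.mul_const ‖z‖).mono' (hf z) (Eventually.of_forall fun ω => (f ω).le_opNorm z)
  refine ⟨hint, LinearMap.mkContinuous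
    { toFun := fun z => ∫ ω, f ω z ∂μ
      map_add' := fun x y => by
        simp only [map_add]
        exact integral_add (hint x) (hint y)
      map_smul' := fun c x => by
        simp only [map_smul, RingHom.id_apply]
        exact integral_smul c fun ω => f ω x } (∫ ω, ‖f ω‖ ∂μ) fun z => ?_, fun z => rfl⟩
  change ‖∫ ω, f ω z ∂μ‖ ≤ (∫ ω, ‖f ω‖ ∂μ) * ‖z‖
  rw [← integral_mul_const]
  exact norm_integral_le_of_norm_le (hnorm.mul_const ‖z‖)
    (Eventually.of_forall fun ω => (f ω).le_opNorm z)

/-- Leibniz rule for Gelfand integral functionals with strictly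
differentiable integrands: `I_φ` is locally Lipschitz around `x̄`, strictly
differentiable at `x̄`, and its strict derivative is the Gelfand integral of the
strict partial derivatives. -/
theorem strict_derivative_leibniz_rule
    {X : Type u} [NormedAddCommGroup X] [NormedSpace ℝ X] [CompleteSpace X]
    {Ω : Type v} [MeasurableSpace Ω] (μ : Measure Ω)
    (hcomp : μ.IsComplete) [IsFiniteMeasure μ]
    (φ : X → Ω → ℝ) (xbar : X) (U : Set X) (hU : U ∈ 𝓝 xbar)
    (l : Ω → ℝ) (hl : Integrable l μ)
    (hLip : ∀ ω, ∀ x ∈ U, ∀ x' ∈ U, |φ x ω - φ x' ω| ≤ l ω * ‖x - x'‖)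
    (hmeas : ∀ x ∈ U, Measurable fun ω => φ x ω)
    (hint : ∀ x ∈ U, Integrable (fun ω => φ x ω) μ)
    (Dφ : Ω → X →L[ℝ] ℝ)
    (hdiff : ∀ ω, HasStrictFDerivAt (fun x => φ x ω) (Dφ ω) xbar)
    (hnorm : Integrable (fun ω => ‖Dφ ω‖) μ) :
    (∃ K : ℝ, ∃ t ∈ 𝓝 xbar, ∀ x ∈ t, ∀ x' ∈ t,
        |(∫ ω, φ x ω ∂μ) - ∫ ω, φ x' ω ∂μ| ≤ K * ‖x - x'‖) ∧
    (∀ z : X, Integrable (fun ω => Dφ ω z) μ) ∧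
    ∃ D : X →L[ℝ] ℝ, HasStrictFDerivAt (fun x => ∫ ω, φ x ω ∂μ) D xbar ∧
      ∀ z : X, D z = ∫ ω, Dφ ω z ∂μ := by
  have hgelf : GelfandIntegrable μ Dφ := gelfandIntegrable_of_integrable_norm
    (aestronglyMeasurable_apply_of_hasFDerivAt hU
      (fun x hx => (hmeas x hx).aestronglyMeasurable) fun ω => (hdiff ω).hasFDerivAt) hnorm
  refine ⟨⟨∫ ω, l ω ∂μ, U, hU, fun x hx x' hx' => ?_⟩, hgelf.1, ?_⟩
  · rw [← integral_sub (hint x hx) (hint x' hx'), ← integral_mul_const]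
    exact norm_integral_le_of_norm_le (f := fun ω => φ x ω - φ x' ω) (hl.mul_const ‖x - x'‖)
      (Eventually.of_forall fun ω => hLip ω x hx x' hx')
  obtain ⟨D, hD⟩ := hgelf.2
  refine ⟨D, ?_, hD⟩
  have hUU : ∀ᶠ p : X × X in 𝓝 (xbar, xbar), p.1 ∈ U ∧ p.2 ∈ U := prod_mem_nhds hU hU
  have hquot : Tendsto (fun p : X × X => ∫ ω, ‖p.1 - p.2‖⁻¹ *
      (φ p.1 ω - φ p.2 ω - Dφ ω (p.1 - p.2)) ∂μ) (𝓝 (xbar, xbar)) (𝓝 (∫ _, (0 : ℝ) ∂μ)) := by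
    refine tendsto_integral_filter_of_dominated_convergence (fun ω => |l ω| + ‖Dφ ω‖)
      ?_ ?_ (hl.abs.add hnorm) (Eventually.of_forall fun ω => ?_)
    · filter_upwards [hUU] with p hp
      exact ((((hint _ hp.1).sub (hint _ hp.2)).sub (hgelf.1 _)).const_mul _).aestronglyMeasurable
    · filter_upwards [hUU] with p hp
      refine Eventually.of_forall fun ω => ?_
      rw [norm_mul, norm_inv, norm_norm]
      refine inv_mul_le_of_le_mul₀ (norm_nonneg _) (by positivity) ?_
      calc ‖φ p.1 ω - φ p.2 ω - Dφ ω (p.1 - p.2)‖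
          ≤ ‖φ p.1 ω - φ p.2 ω‖ + ‖Dφ ω (p.1 - p.2)‖ := norm_sub_le _ _
        _ ≤ |l ω| * ‖p.1 - p.2‖ + ‖Dφ ω‖ * ‖p.1 - p.2‖ := by
          gcongr
          · exact (hLip ω _ hp.1 _ hp.2).trans (by gcongr; exact le_abs_self _)
          · exact (Dφ ω).le_opNorm _
        _ = ‖p.1 - p.2‖ * (|l ω| + ‖Dφ ω‖) := by ring
    · have h := (hdiff ω).isLittleO.norm_right.tendsto_div_nhds_zero
      simpa only [div_eq_inv_mul] using h
  rw [integral_zero] at hquot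
  refine HasStrictFDerivAt.of_isLittleO (Asymptotics.isLittleO_norm_right.1 ?_)
  refine (Asymptotics.isLittleO_iff_tendsto' ?_).2 (hquot.congr' ?_)
  · refine Eventually.of_forall fun p hp => ?_
    rw [norm_eq_zero, sub_eq_zero] at hp
    simp [hp]
  · filter_upwards [hUU] with p hp
    have hsub : Integrable (fun ω => φ p.1 ω - φ p.2 ω) μ := (hint _ hp.1).sub (hint _ hp.2)
    rw [integral_const_mul, integral_sub hsub (hgelf.1 _),
      integral_sub (hint _ hp.1) (hint _ hp.2), ← hD, div_eq_inv_mul]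

end Paper
end
end
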